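/- arXiv:2310.08695 — 2 statements merged into one kernel-verified Lean document; each statement's English description precedes it below -/
import Mathlib

section
/- For every continuous function f : S² → ℝ on the unit sphere S² ⊂ ℝ³, the averages (1/|P_n|) Σ_{(x,y,z,t) ∈ P_n} f(x/t, y/t, z/t) converge, as n → ∞, to (1/(4π)) ∫_{S²} f dσ, where σ is the surface measure on S². In other words, the primitive Pythagorean quadruples, ordered by hypotenuse, equidistribute on the unit sphere. -/
open MeasureTheory

/-- The set of (signed) primitive Pythagorean quadruples `(x, y, z, t)` with
`x² + y² + z² = t²`, `gcd(x, y, z, t) = 1`, and positive hypotenuse `t ≤ n`. -/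
def PythQuad (n : ℕ) : Set (ℤ × ℤ × ℤ × ℤ) :=
  {q : ℤ × ℤ × ℤ × ℤ |
    0 < q.2.2.2 ∧
    q.1 ^ 2 + q.2.1 ^ 2 + q.2.2.1 ^ 2 = q.2.2.2 ^ 2 ∧
    Int.gcd q.1 (Int.gcd q.2.1 (Int.gcd q.2.2.1 q.2.2.2 : ℤ) : ℤ) = 1 ∧
    q.2.2.2 ≤ (n : ℤ)}

/-- The point `(x/t, y/t, z/t)` of the unit sphere `S² ⊂ ℝ³` determined by a
Pythagorean quadruple `(x, y, z, t)`. -/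
noncomputable def pythPoint (q : ℤ × ℤ × ℤ × ℤ) : EuclideanSpace ℝ (Fin 3) :=
  (WithLp.equiv 2 (Fin 3 → ℝ)).symm
    ![(q.1 : ℝ) / (q.2.2.2 : ℝ), (q.2.1 : ℝ) / (q.2.2.2 : ℝ), (q.2.2.1 : ℝ) / (q.2.2.2 : ℝ)]

open Filter Topology

/-- If `w` is a nonnegative summable weight of total mass less than `c`, then convergence at
infinity of `c φ(x) + ∑ᵢ wᵢ φ(x / kᵢ)` forces convergence of the bounded function `φ`. -/
theorem tendsto_of_tendsto_add_tsum_dilates {ι : Type*} {w k : ι → ℝ} {φ : ℝ → ℝ} {c C a : ℝ}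
    (hw : ∀ i, 0 ≤ w i) (hws : Summable w) (hwc : ∑' i, w i < c) (hk : ∀ i, 0 < k i)
    (hφ : ∀ x, |φ x| ≤ C)
    (h : Tendsto (fun x => c * φ x + ∑' i, w i * φ (x / k i)) atTop (𝓝 a)) :
    Tendsto φ atTop (𝓝 (a / (c + ∑' i, w i))) := by
  set ρ := ∑' i, w i with hρ
  have hρ0 : 0 ≤ ρ := tsum_nonneg hw
  set b := a / (c + ρ) with hb
  have hab : a = c * b + ρ * b := by
    have : c + ρ ≠ 0 := by linarith
    rw [hb]; field_simp
  set ψ : ℝ → ℝ := fun x => |φ x - b| with hψ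
  set D := C + |b|
  have hψD : ∀ x, ψ x ≤ D := fun x => (abs_sub _ _).trans (add_le_add (hφ x) le_rfl)
  have hψ0 : ∀ x, 0 ≤ ψ x := fun x => abs_nonneg _
  have hbdd : IsBoundedUnder (· ≤ ·) atTop ψ := isBoundedUnder_of ⟨D, hψD⟩
  have hcob : IsCoboundedUnder (· ≤ ·) atTop ψ :=
    (isBoundedUnder_of ⟨0, hψ0⟩ : IsBoundedUnder (· ≥ ·) atTop ψ).isCoboundedUnder_le
  set L := limsup ψ atTop with hL
  have hL0 : 0 ≤ L := le_limsup_of_frequently_le (Frequently.of_forall hψ0) hbdd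
  set η : ℝ → ℝ := fun x => max (ψ x - L) 0 with hη
  have hη_lim : Tendsto η atTop (𝓝 0) := by
    rw [tendsto_order]
    refine ⟨fun e he => Eventually.of_forall fun x => he.trans_le (le_max_right _ _),
      fun e he => ?_⟩
    filter_upwards [eventually_lt_of_limsup_lt (show limsup ψ atTop < L + e by linarith) hbdd]
      with x hx
    exact max_lt (by linarith) he
  have hD0 : 0 ≤ D := (hψ0 0).trans (hψD 0)
  have hηD : ∀ x, η x ≤ D := fun x => max_le (by linarith [hψD x]) hD0
  have hη0 : ∀ x, 0 ≤ η x := fun x => le_max_right _ _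
  have hsum_lim : Tendsto (fun x => ∑' i, w i * η (x / k i)) atTop (𝓝 0) := by
    have := tendsto_tsum_of_dominated_convergence (𝓕 := atTop) (bound := fun i => w i * D)
      (f := fun (x : ℝ) i => w i * η (x / k i)) (g := fun _ => 0) (hws.mul_right D)
      (fun i => by
        simpa using ((hη_lim.comp (tendsto_id.atTop_div_const (hk i))).const_mul (w i)))
      (Eventually.of_forall fun x i => by
        rw [Real.norm_of_nonneg (mul_nonneg (hw i) (hη0 _))]
        exact mul_le_mul_of_nonneg_left (hηD _) (hw i))
    simpa using this
  have hc0 : 0 < c := hρ0.trans_lt hwc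
  have hsφ : ∀ x, Summable fun i => w i * φ (x / k i) := fun x =>
    Summable.of_norm_bounded (g := fun i => w i * C) (hws.mul_right C) fun i => by
      rw [norm_mul, Real.norm_of_nonneg (hw i)]
      exact mul_le_mul_of_nonneg_left (hφ _) (hw i)
  have hsψ : ∀ x, Summable fun i => w i * ψ (x / k i) := fun x =>
    Summable.of_norm_bounded (g := fun i => w i * D) (hws.mul_right D) fun i => by
      rw [norm_mul, Real.norm_of_nonneg (hw i), Real.norm_of_nonneg (hψ0 _)]
      exact mul_le_mul_of_nonneg_left (hψD _) (hw i)
  have hsη : ∀ x, Summable fun i => w i * η (x / k i) := fun x =>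
    Summable.of_norm_bounded (g := fun i => w i * D) (hws.mul_right D) fun i => by
      rw [norm_mul, Real.norm_of_nonneg (hw i), Real.norm_of_nonneg (hη0 _)]
      exact mul_le_mul_of_nonneg_left (hηD _) (hw i)
  have key : ∀ x, c * ψ x ≤ |c * φ x + ∑' i, w i * φ (x / k i) - a| +
      (ρ * L + ∑' i, w i * η (x / k i)) := by
    intro x
    have e1 : c * (φ x - b) = (c * φ x + ∑' i, w i * φ (x / k i) - a)
        - ∑' i, w i * (φ (x / k i) - b) := by
      have : ∑' i, w i * (φ (x / k i) - b) = ∑' i, w i * φ (x / k i) - ρ * b := by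
        simp_rw [mul_sub]
        rw [(hsφ x).tsum_sub (hws.mul_right b), tsum_mul_right]
      rw [this, hab]; ring
    have e2 : |∑' i, w i * (φ (x / k i) - b)| ≤ ∑' i, w i * ψ (x / k i) := by
      rw [← Real.norm_eq_abs]
      refine tsum_of_norm_bounded (hsψ x).hasSum fun i => ?_
      rw [norm_mul, Real.norm_of_nonneg (hw i)]
      rfl
    have e3 : ∑' i, w i * ψ (x / k i) ≤ ρ * L + ∑' i, w i * η (x / k i) := by
      rw [hρ, ← tsum_mul_right, ← (hws.mul_right L).tsum_add (hsη x)]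
      refine (hsψ x).tsum_le_tsum (fun i => ?_) ((hws.mul_right L).add (hsη x))
      rw [← mul_add]
      exact mul_le_mul_of_nonneg_left (by linarith [le_max_left (ψ (x / k i) - L) 0]) (hw i)
    calc c * ψ x = |c * (φ x - b)| := by rw [abs_mul, abs_of_pos hc0]
      _ ≤ _ := by
        rw [e1]
        exact (abs_sub _ _).trans (by gcongr; exact e2.trans e3)
  have hlim : Tendsto (fun x => (|c * φ x + ∑' i, w i * φ (x / k i) - a| +
      (ρ * L + ∑' i, w i * η (x / k i))) / c) atTop (𝓝 (ρ * L / c)) := by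
    have := (((h.sub_const a).abs).add (hsum_lim.const_add (ρ * L))).div_const c
    simpa using this
  have hLle : L ≤ ρ * L / c := by
    rw [← hlim.limsup_eq]
    refine limsup_le_limsup (Eventually.of_forall fun x => ?_) hcob hlim.isBoundedUnder_le
    rw [le_div_iff₀ hc0, mul_comm]
    exact key x
  have hLz : L = 0 := by
    rw [le_div_iff₀ hc0] at hLle
    nlinarith
  have hηψ : η = ψ := by
    ext x
    simp [hη, hLz, hψ0 x]
  rw [hηψ] at hη_lim
  exact tendsto_sub_nhds_zero_iff.1 ((tendsto_zero_iff_abs_tendsto_zero _).2 hη_lim)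

theorem continuous_sum_sq {ι : Type*} [Fintype ι] : Continuous fun v : ι → ℝ => ∑ i, v i ^ 2 := by
  fun_prop

theorem isBounded_sum_sq_le {ι : Type*} [Fintype ι] (x : ℝ) :
    Bornology.IsBounded {v : ι → ℝ | ∑ i, v i ^ 2 ≤ x} := by
  refine (Metric.isBounded_closedBall (x := 0) (r := √x)).subset fun v hv => ?_
  rw [mem_closedBall_zero_iff, pi_norm_le_iff_of_nonneg (Real.sqrt_nonneg _)]
  intro i
  refine Real.abs_le_sqrt (le_trans ?_ hv)
  exact Finset.single_le_sum (f := fun i => v i ^ 2) (fun j _ => sq_nonneg _) (Finset.mem_univ i)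

theorem volume_frontier_sum_sq_le {ι : Type*} [Fintype ι] (x : ℝ) :
    volume (frontier {v : ι → ℝ | ∑ i, v i ^ 2 ≤ x}) = 0 := by
  refine Convex.addHaar_frontier volume ?_
  have : ConvexOn ℝ Set.univ fun v : ι → ℝ => ∑ i, v i ^ 2 := by
    have h : ∀ i ∈ (Finset.univ : Finset ι), ConvexOn ℝ Set.univ fun v : ι → ℝ => v i ^ 2 := by
      intro i _
      have := (even_two.convexOn_pow (𝕜 := ℝ)).comp_linearMap (LinearMap.proj (R := ℝ) (φ := fun _ : ι => ℝ) i)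
      simpa [Function.comp_def] using this
    have := Finset.sum_induction (s := Finset.univ) (fun (i : ι) (v : ι → ℝ) => v i ^ 2)
      (ConvexOn ℝ Set.univ) (fun _ _ => ConvexOn.add) (convexOn_const 0 convex_univ) h
    simpa [Finset.sum_fn] using this
  simpa using this.convex_le x

theorem finite_lattice_sum_sq_le {ι : Type*} [Fintype ι] (L : Submodule ℤ (ι → ℝ))
    [DiscreteTopology L] (x : ℝ) : {v | v ∈ L ∧ ∑ i, v i ^ 2 ≤ x}.Finite := by
  have : DiscreteTopology L.toAddSubgroup := inferInstanceAs (DiscreteTopology L)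
  have h := Metric.finite_isBounded_inter_isClosed (s := (L.toAddSubgroup : Set (ι → ℝ)))
    DiscreteTopology.isDiscrete (isBounded_sum_sq_le x) AddSubgroup.isClosed_of_discrete
  exact h.subset fun v hv => ⟨hv.2, hv.1⟩

theorem finset_sum_eq_integral_card_le {α : Type*} (S : Finset α) {g : α → ℝ} {M : ℝ}
    (h0 : ∀ v, 0 ≤ g v) (hM : ∀ v, g v ≤ M) :
    ∑ v ∈ S, g v = ∫ t in Set.Ioc 0 M, (Nat.card {v | v ∈ S ∧ t ≤ g v} : ℝ) := by
  let _ : MeasurableSpace α := ⊤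
  have hfin : IsFiniteMeasure (Measure.count.restrict (S : Set α)) := ⟨by simp⟩
  have hint : Integrable g (Measure.count.restrict (S : Set α)) :=
    Integrable.of_bound (C := M) (measurable_from_top.aestronglyMeasurable)
      (Eventually.of_forall fun v => by rw [Real.norm_of_nonneg (h0 v)]; exact hM v)
  have := hint.integral_eq_integral_Ioc_meas_le (Eventually.of_forall h0) (Eventually.of_forall hM)
  rw [setIntegral_finset S hint] at this
  simp only [count_real_singleton, one_smul] at this
  rw [this]
  refine integral_congr_ae (Eventually.of_forall fun t => ?_)
  classical
  have e : {a | t ≤ g a} ∩ (S : Set α) = ((S.filter fun v => t ≤ g v : Finset α) : Set α) := by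
    ext v; simp [and_comm]
  have e' : {v | v ∈ S ∧ t ≤ g v} = ((S.filter fun v => t ≤ g v : Finset α) : Set α) := by
    ext v; simp
  simp only [Measure.real]
  rw [Measure.restrict_apply MeasurableSpace.measurableSet_top, e, e', Measure.count_apply_finset, Nat.card_coe_set_eq,
    Set.ncard_coe_finset]
  simp

section LatticeSum

variable (L : Submodule ℤ (Fin 4 → ℝ)) [DiscreteTopology L] [IsZLattice ℝ L]

theorem frontier_superlevel_subset {E : Type*} [TopologicalSpace E] {g : E → ℝ} (z : E)
    (hgc : ∀ v ≠ z, ContinuousAt g v) (t : ℝ) : frontier {v | t ≤ g v} ⊆ {z} ∪ {v | g v = t} := by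
  intro v hv
  by_contra hcon
  simp only [Set.mem_union, Set.mem_singleton_iff, Set.mem_ofPred_eq, not_or] at hcon
  obtain ⟨hvz, hvt⟩ := hcon
  rcases lt_or_gt_of_ne hvt with h | h
  · have := (hgc v hvz).eventually (gt_mem_nhds h)
    obtain ⟨u, hu1, hu2⟩ := mem_closure_iff_frequently.1 hv.1 |>.and_eventually this |>.exists
    exact absurd hu2 (not_lt.2 hu1)
  · have := (hgc v hvz).eventually (lt_mem_nhds h)
    exact hv.2 (mem_interior_iff_mem_nhds.2 (this.mono fun u hu => hu.le))

theorem tendsto_card_lattice_superlevel {g : (Fin 4 → ℝ) → ℝ} (hgm : Measurable g)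
    (hgc : ∀ v ≠ 0, ContinuousAt g v) (hgh : ∀ v, ∀ r : ℝ, 0 < r → g (r • v) = g v) {t : ℝ}
    (ht : volume {v | g v = t} = 0) :
    Tendsto (fun x : ℝ => (Nat.card {v | (v ∈ L ∧ ∑ i, v i ^ 2 ≤ x) ∧ t ≤ g v} : ℝ) / x ^ 2) atTop
      (𝓝 (volume.real {v | t ≤ g v ∧ ∑ i, v i ^ 2 ≤ 1} / ZLattice.covolume L)) := by
  have hS : ∀ c : ℝ, 0 ≤ c → {v : Fin 4 → ℝ | v ∈ {v | t ≤ g v} ∧ (∑ i, v i ^ 2) ^ 2 ≤ c ^ 2} =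
      {v | t ≤ g v ∧ ∑ i, v i ^ 2 ≤ c} := by
    intro c hc
    ext v
    simp only [Set.mem_ofPred_eq, and_congr_right_iff]
    intro _
    rw [sq_le_sq₀ (Finset.sum_nonneg fun i _ => sq_nonneg _) hc]
  have h1 := hS 1 zero_le_one
  rw [one_pow] at h1
  have main := ZLattice.covolume.tendsto_card_le_div L (X := {v | t ≤ g v})
    (F := fun v => (∑ i, v i ^ 2) ^ 2)
    (fun v r hv hr => by simpa [hgh v r hr] using hv)
    (fun v r _ => by
      simp only [Pi.smul_apply, smul_eq_mul, mul_pow, ← Finset.mul_sum, Fintype.card_fin]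
      ring)
    (by rw [h1]; exact (isBounded_sum_sq_le 1).subset fun v hv => hv.2)
    (by
      rw [h1]
      exact (measurableSet_le measurable_const hgm).inter
        (measurableSet_le continuous_sum_sq.measurable measurable_const))
    (by
      rw [h1, Set.ofPred_and]
      refine measure_mono_null ((frontier_inter_subset _ _).trans
        (Set.union_subset_union Set.inter_subset_left Set.inter_subset_right)) ?_
      refine measure_union_null (measure_mono_null (frontier_superlevel_subset 0 hgc t)
        (measure_union_null (measure_singleton _) ht)) (volume_frontier_sum_sq_le 1))
  rw [h1] at main
  refine ((main.comp (tendsto_pow_atTop two_ne_zero)).congr' ?_)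
  filter_upwards [eventually_ge_atTop 0] with x hx
  have hS' := hS x hx
  simp only [Set.mem_ofPred_eq] at hS'
  simp only [Function.comp_apply]
  rw [hS']
  congr 4
  ext v
  simp only [Set.mem_inter_iff, Set.mem_ofPred_eq, SetLike.mem_coe]
  tauto

theorem tendsto_lattice_sum_of_nonneg {g : (Fin 4 → ℝ) → ℝ} {M : ℝ} (hgm : Measurable g)
    (hgc : ∀ v ≠ 0, ContinuousAt g v) (hgh : ∀ v, ∀ r : ℝ, 0 < r → g (r • v) = g v)
    (h0 : ∀ v, 0 ≤ g v) (hM : ∀ v, g v ≤ M) :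
    Tendsto (fun x : ℝ => (∑ v ∈ (finite_lattice_sum_sq_le L x).toFinset, g v) / x ^ 2) atTop
      (𝓝 ((∫ v in {v | ∑ i, v i ^ 2 ≤ 1}, g v) / ZLattice.covolume L)) := by
  have hms : MeasurableSet {v : Fin 4 → ℝ | ∑ i, v i ^ 2 ≤ 1} :=
    measurableSet_le continuous_sum_sq.measurable measurable_const
  have hfin : IsFiniteMeasure (volume.restrict {v : Fin 4 → ℝ | ∑ i, v i ^ 2 ≤ 1}) :=
    ⟨by simpa using (isBounded_sum_sq_le 1).measure_lt_top⟩
  have hint := Integrable.integral_eq_integral_Ioc_meas_le (M := M) (f := g)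
    (μ := volume.restrict {v : Fin 4 → ℝ | ∑ i, v i ^ 2 ≤ 1})
    (Integrable.of_bound (C := M) hgm.aestronglyMeasurable
      (Eventually.of_forall fun v => by rw [Real.norm_of_nonneg (h0 v)]; exact hM v))
      (Eventually.of_forall h0) (Eventually.of_forall hM)
  have hreal : ∀ t, (volume.restrict {v : Fin 4 → ℝ | ∑ i, v i ^ 2 ≤ 1}).real {v | t ≤ g v} =
      volume.real {v | t ≤ g v ∧ ∑ i, v i ^ 2 ≤ 1} := fun t => by
    rw [measureReal_restrict_apply (measurableSet_le measurable_const hgm)]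
    rfl
  simp_rw [hreal] at hint
  rw [hint, ← integral_div]
  simp_rw [finset_sum_eq_integral_card_le _ h0 hM, ← integral_div]
  simp only [Set.Finite.mem_toFinset, Set.mem_ofPred_eq]
  have htot := tendsto_card_lattice_superlevel L (g := fun _ => 0) (t := -1) measurable_const
    (fun _ _ => continuousAt_const) (fun _ _ _ => rfl) (by simp)
  simp only [Left.neg_nonpos_iff, zero_le_one, and_true] at htot
  obtain ⟨B, hB⟩ := htot.isBoundedUnder_le
  rw [eventually_map] at hB
  refine tendsto_integral_filter_of_dominated_convergence (fun _ => B) ?_ ?_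
    (integrable_const _) ?_
  · refine Eventually.of_forall fun x => Measurable.aestronglyMeasurable ?_
    refine Measurable.div_const (Antitone.measurable fun s t hst => ?_) _
    have : {v | (v ∈ L ∧ ∑ i, v i ^ 2 ≤ x) ∧ t ≤ g v} ⊆
        {v | (v ∈ L ∧ ∑ i, v i ^ 2 ≤ x) ∧ s ≤ g v} := fun v hv => ⟨hv.1, hst.trans hv.2⟩
    exact_mod_cast Nat.card_mono ((finite_lattice_sum_sq_le L x).subset fun v hv => hv.1) this
  · filter_upwards [hB] with x hx
    refine Eventually.of_forall fun t => ?_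
    rw [Real.norm_of_nonneg (by positivity)]
    refine le_trans ?_ hx
    gcongr
    exact Nat.card_mono (finite_lattice_sum_sq_le L x) fun v hv => hv.1
  · have hc : Set.Countable {t | 0 < volume {v | g v = t}} :=
      Measure.countable_meas_level_set_pos hgm
    filter_upwards [ae_restrict_of_ae (hc.ae_notMem volume)] with t ht
    exact tendsto_card_lattice_superlevel L hgm hgc hgh (by simpa using ht)

/-- Lattice points in large Euclidean balls of `ℝ⁴` are equidistributed with respect to bounded
functions that are homogeneous of degree zero and continuous away from the origin. -/
theorem tendsto_lattice_sum {g : (Fin 4 → ℝ) → ℝ} {M : ℝ} (hgm : Measurable g)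
    (hgc : ∀ v ≠ 0, ContinuousAt g v) (hgh : ∀ v, ∀ r : ℝ, 0 < r → g (r • v) = g v)
    (hM : ∀ v, |g v| ≤ M) :
    Tendsto (fun x : ℝ => (∑ v ∈ (finite_lattice_sum_sq_le L x).toFinset, g v) / x ^ 2) atTop
      (𝓝 ((∫ v in {v | ∑ i, v i ^ 2 ≤ 1}, g v) / ZLattice.covolume L)) := by
  have hfin : IsFiniteMeasure (volume.restrict {v : Fin 4 → ℝ | ∑ i, v i ^ 2 ≤ 1}) :=
    ⟨by simpa using (isBounded_sum_sq_le 1).measure_lt_top⟩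
  have h0 : 0 ≤ M := (abs_nonneg _).trans (hM 0)
  have h1 := tendsto_lattice_sum_of_nonneg L (g := fun v => g v + M) (M := M + M)
    (hgm.add_const M) (fun v hv => (hgc v hv).add continuousAt_const)
    (fun v r hr => by rw [hgh v r hr]) (fun v => by linarith [(abs_le.1 (hM v)).1])
    (fun v => by linarith [(abs_le.1 (hM v)).2])
  have h2 := tendsto_lattice_sum_of_nonneg L (g := fun v => M) (M := M)
    measurable_const (fun v hv => continuousAt_const) (fun v r hr => rfl) (fun v => h0)
    (fun v => le_rfl)
  have h3 := h1.sub h2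
  rw [integral_add (Integrable.of_bound (C := M) hgm.aestronglyMeasurable
      (Eventually.of_forall fun v => hM v)) (integrable_const _), add_div, add_sub_cancel_right]
    at h3
  refine h3.congr fun x => ?_
  rw [Finset.sum_add_distrib, add_div, add_sub_cancel_right]

end LatticeSum

/-- The norm `|α|² + |β|²` of a pair of Gaussian integers. -/
def pairNorm (v : GaussianInt × GaussianInt) : ℤ := v.1.norm + v.2.norm

/-- The real vector of coordinates of a pair of Gaussian integers, ordered in such a way that the
Hopf map becomes the first column of the Euler-Rodrigues rotation matrix. -/
def pairVec (v : GaussianInt × GaussianInt) : Fin 4 → ℝ := ![v.1.re, v.1.im, v.2.im, v.2.re]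

theorem pairNorm_eq (v : GaussianInt × GaussianInt) :
    pairNorm v = v.1.re ^ 2 + v.1.im ^ 2 + v.2.im ^ 2 + v.2.re ^ 2 := by
  simp only [pairNorm, Zsqrtd.norm_def]; ring

theorem sum_sq_pairVec (v : GaussianInt × GaussianInt) :
    ∑ i, pairVec v i ^ 2 = pairNorm v := by
  simp [pairNorm_eq, pairVec, Fin.sum_univ_four]

theorem pairVec_injective : Function.Injective pairVec := by
  intro v w h
  have h0 := congrFun h 0
  have h1 := congrFun h 1
  have h2 := congrFun h 2
  have h3 := congrFun h 3
  simp only [pairVec, Matrix.cons_val, Int.cast_inj] at h0 h1 h2 h3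
  ext <;> assumption

theorem odd_pairNorm_iff (v : GaussianInt × GaussianInt) :
    Odd (pairNorm v) ↔ Odd (v.1.re + v.1.im + v.2.im + v.2.re) := by
  rw [pairNorm_eq]
  simp only [Int.odd_add, Int.even_pow' two_ne_zero, Int.odd_pow' two_ne_zero, parity_simps]

/-- A basis of the lattice of integer vectors with even coordinate sum. -/
noncomputable def evenBasis : Module.Basis (Fin 4) ℝ (Fin 4 → ℝ) :=
  Module.Basis.ofEquivFun
    { toFun := fun v => ![v 0, v 1, v 2, (v 3 - v 0 - v 1 - v 2) / 2]
      invFun := fun v => ![v 0, v 1, v 2, v 0 + v 1 + v 2 + 2 * v 3]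
      map_add' := fun v w => by
        ext i; fin_cases i <;> simp <;> ring
      map_smul' := fun r v => by
        ext i; fin_cases i <;> simp <;> ring
      left_inv := fun v => by
        ext i; fin_cases i <;> simp <;> ring
      right_inv := fun v => by
        ext i; fin_cases i <;> simp
        ring }

theorem mem_span_evenBasis_iff (x : Fin 4 → ℝ) :
    x ∈ Submodule.span ℤ (Set.range evenBasis) ↔
      ∃ v, ¬ Odd (pairNorm v) ∧ pairVec v = x := by
  rw [evenBasis.mem_span_iff_repr_mem ℤ]
  have hrepr : ∀ i, evenBasis.repr x i =
      (![x 0, x 1, x 2, (x 3 - x 0 - x 1 - x 2) / 2] : Fin 4 → ℝ) i := fun i => by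
    rw [← Module.Basis.equivFun_apply, evenBasis, Module.Basis.equivFun_ofEquivFun]; rfl
  simp only [hrepr, Fin.forall_fin_succ, Matrix.cons_val]
  simp only [odd_pairNorm_iff, Int.not_odd_iff_even]
  constructor
  · rintro ⟨⟨a, ha⟩, ⟨b, hb⟩, ⟨c, hc⟩, ⟨d, hd⟩, -⟩
    simp at ha hb hc hd
    refine ⟨(⟨a, b⟩, ⟨a + b + c + 2 * d, c⟩), ⟨a + b + c + d, by ring⟩, ?_⟩
    ext i
    fin_cases i
    · simp [pairVec, ha]
    · simp [pairVec, hb]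
    · simp [pairVec, hc]
    · simp [pairVec, ha, hb, hc, hd]
      ring
  · rintro ⟨v, ⟨d, hd⟩, rfl⟩
    have hd' : (v.1.re + v.1.im + v.2.im + v.2.re : ℝ) = d + d := by exact_mod_cast hd
    refine ⟨⟨v.1.re, by simp [pairVec]⟩, ⟨v.1.im, by simp [pairVec]⟩, ⟨v.2.im, by simp [pairVec]⟩,
      ⟨d - v.1.re - v.1.im - v.2.im, ?_⟩, by simp⟩
    change ((d - v.1.re - v.1.im - v.2.im : ℤ) : ℝ) = (v.2.re - v.1.re - v.1.im - v.2.im) / 2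
    push_cast
    linarith

theorem mem_span_basisFun_iff (x : Fin 4 → ℝ) :
    x ∈ Submodule.span ℤ (Set.range (Pi.basisFun ℝ (Fin 4))) ↔ ∃ v, pairVec v = x := by
  rw [(Pi.basisFun ℝ (Fin 4)).mem_span_iff_repr_mem ℤ]
  simp only [Pi.basisFun_repr]
  constructor
  · intro h
    choose a ha using h
    refine ⟨(⟨a 0, a 1⟩, ⟨a 3, a 2⟩), ?_⟩
    ext i
    fin_cases i <;> simp [pairVec, ← ha]
  · rintro ⟨v, rfl⟩ i
    fin_cases i <;> simp [pairVec, -GaussianInt.intCast_re, -GaussianInt.intCast_im]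

theorem covolume_span_basisFun :
    ZLattice.covolume (Submodule.span ℤ (Set.range (Pi.basisFun ℝ (Fin 4)))) = 1 := by
  rw [ZLattice.covolume_eq_measure_fundamentalDomain _ _ (ZSpan.isAddFundamentalDomain _ volume),
    ZSpan.volume_real_fundamentalDomain]
  have : Matrix.of (Pi.basisFun ℝ (Fin 4)) = (1 : Matrix (Fin 4) (Fin 4) ℝ) := by
    ext i j
    simp [Matrix.one_apply, Pi.single_apply, eq_comm]
  simp [this]

theorem covolume_span_evenBasis :
    ZLattice.covolume (Submodule.span ℤ (Set.range evenBasis)) = 2 := by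
  rw [ZLattice.covolume_eq_measure_fundamentalDomain _ _ (ZSpan.isAddFundamentalDomain _ volume),
    ZSpan.volume_real_fundamentalDomain]
  have : Matrix.of evenBasis =
      (!![1, 0, 0, 1; 0, 1, 0, 1; 0, 0, 1, 1; 0, 0, 0, 2] : Matrix (Fin 4) (Fin 4) ℝ) := by
    ext i j
    rw [Matrix.of_apply, evenBasis, Module.Basis.coe_ofEquivFun]
    fin_cases i <;> fin_cases j <;> simp
  rw [this]
  simp [Matrix.det_succ_row_zero, Fin.sum_univ_succ]

theorem finite_pairNorm_le (x : ℝ) : {v | (pairNorm v : ℝ) ≤ x}.Finite := by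
  refine Set.Finite.of_finite_image (f := pairVec) ?_ pairVec_injective.injOn
  refine (finite_lattice_sum_sq_le (Submodule.span ℤ (Set.range (Pi.basisFun ℝ (Fin 4)))) x).subset
    ?_
  rintro _ ⟨v, hv, rfl⟩
  exact ⟨(mem_span_basisFun_iff _).2 ⟨v, rfl⟩, by rw [sum_sq_pairVec]; exact hv⟩

theorem tendsto_odd_pair_sum {g : (Fin 4 → ℝ) → ℝ} {M : ℝ} (hgm : Measurable g)
    (hgc : ∀ v ≠ 0, ContinuousAt g v) (hgh : ∀ v, ∀ r : ℝ, 0 < r → g (r • v) = g v)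
    (hM : ∀ v, |g v| ≤ M) :
    Tendsto (fun x : ℝ => (∑' v, if Odd (pairNorm v) ∧ (pairNorm v : ℝ) ≤ x then g (pairVec v)
      else 0) / x ^ 2) atTop (𝓝 ((∫ v in {v | ∑ i, v i ^ 2 ≤ 1}, g v) / 2)) := by
  have h := (tendsto_lattice_sum (Submodule.span ℤ (Set.range (Pi.basisFun ℝ (Fin 4))))
    hgm hgc hgh hM).sub (tendsto_lattice_sum (Submodule.span ℤ (Set.range evenBasis))
    hgm hgc hgh hM)
  rw [covolume_span_basisFun, covolume_span_evenBasis] at h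
  convert h using 2 with x
  · rw [← sub_div]
    congr 1
    classical
    have hall : ∑ v ∈ (finite_lattice_sum_sq_le
        (Submodule.span ℤ (Set.range (Pi.basisFun ℝ (Fin 4)))) x).toFinset, g v =
        ∑ v ∈ (finite_pairNorm_le x).toFinset, g (pairVec v) := by
      refine (Finset.sum_nbij pairVec ?_ pairVec_injective.injOn ?_ fun _ _ => rfl).symm
      · intro v hv
        simpa [mem_span_basisFun_iff, sum_sq_pairVec] using hv
      · intro u hu
        simp only [Set.Finite.coe_toFinset, Set.mem_ofPred_eq, mem_span_basisFun_iff] at hu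
        obtain ⟨⟨v, rfl⟩, hv⟩ := hu
        exact ⟨v, by simpa [sum_sq_pairVec] using hv, rfl⟩
    have heven : ∑ v ∈ (finite_lattice_sum_sq_le
        (Submodule.span ℤ (Set.range evenBasis)) x).toFinset, g v =
        ∑ v ∈ (finite_pairNorm_le x).toFinset with ¬ Odd (pairNorm v), g (pairVec v) := by
      refine (Finset.sum_nbij pairVec ?_ pairVec_injective.injOn ?_ fun _ _ => rfl).symm
      · intro v hv
        simp only [Finset.mem_filter, Set.Finite.mem_toFinset, Set.mem_ofPred_eq] at hv
        simp only [Set.Finite.mem_toFinset, Set.mem_ofPred_eq, mem_span_evenBasis_iff,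
          sum_sq_pairVec]
        exact ⟨⟨v, hv.2, rfl⟩, hv.1⟩
      · intro u hu
        simp only [Set.Finite.coe_toFinset, Set.mem_ofPred_eq, mem_span_evenBasis_iff] at hu
        obtain ⟨⟨v, hv', rfl⟩, hv⟩ := hu
        refine ⟨v, ?_, rfl⟩
        simp only [Finset.coe_filter, Set.Finite.mem_toFinset, Set.mem_ofPred_eq]
        exact ⟨by simpa [sum_sq_pairVec] using hv, hv'⟩
    rw [hall, heven, ← Finset.sum_filter_add_sum_filter_not _ (fun v => Odd (pairNorm v)),
      add_sub_cancel_right, Finset.sum_filter]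
    rw [tsum_eq_sum (s := (finite_pairNorm_le x).toFinset)]
    · refine Finset.sum_congr rfl fun v hv => ?_
      simp only [Set.Finite.mem_toFinset, Set.mem_ofPred_eq] at hv
      simp [hv]
    · intro v hv
      simp only [Set.Finite.mem_toFinset, Set.mem_ofPred_eq] at hv
      simp [hv]
  · ring

/-- The Hopf map `u ↦ u i u⁻` from quaternions to imaginary quaternions. -/
noncomputable def hopf (u : Fin 4 → ℝ) : EuclideanSpace ℝ (Fin 3) :=
  !₂[u 0 ^ 2 + u 1 ^ 2 - u 2 ^ 2 - u 3 ^ 2, 2 * (u 1 * u 2 + u 0 * u 3),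
    2 * (u 1 * u 3 - u 0 * u 2)]

/-- The Euler-Rodrigues map `x ↦ u x u⁻` on imaginary quaternions. -/
noncomputable def eulerRodrigues (u : Fin 4 → ℝ) :
    EuclideanSpace ℝ (Fin 3) →ₗ[ℝ] EuclideanSpace ℝ (Fin 3) :=
  Matrix.toEuclideanLin
    !![u 0 ^ 2 + u 1 ^ 2 - u 2 ^ 2 - u 3 ^ 2, 2 * (u 1 * u 2 - u 0 * u 3),
        2 * (u 1 * u 3 + u 0 * u 2);
      2 * (u 1 * u 2 + u 0 * u 3), u 0 ^ 2 - u 1 ^ 2 + u 2 ^ 2 - u 3 ^ 2,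
        2 * (u 2 * u 3 - u 0 * u 1);
      2 * (u 1 * u 3 - u 0 * u 2), 2 * (u 2 * u 3 + u 0 * u 1),
        u 0 ^ 2 - u 1 ^ 2 - u 2 ^ 2 + u 3 ^ 2]

/-- The matrix of right multiplication by the quaternion `h`. -/
def quatMulRight (h : Fin 4 → ℝ) : Matrix (Fin 4) (Fin 4) ℝ :=
  !![h 0, -h 1, -h 2, -h 3; h 1, h 0, h 3, -h 2; h 2, -h 3, h 0, h 1; h 3, h 2, -h 1, h 0]

theorem norm_eulerRodrigues (u : Fin 4 → ℝ) (x : EuclideanSpace ℝ (Fin 3)) :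
    ‖eulerRodrigues u x‖ = (∑ i, u i ^ 2) * ‖x‖ := by
  rw [← sq_eq_sq₀ (norm_nonneg _) (by positivity), mul_pow, EuclideanSpace.real_norm_sq_eq,
    EuclideanSpace.real_norm_sq_eq]
  simp [eulerRodrigues, Matrix.toLpLin_apply, dotProduct, Fin.sum_univ_succ]
  ring

theorem norm_hopf (u : Fin 4 → ℝ) : ‖hopf u‖ = ∑ i, u i ^ 2 := by
  rw [← sq_eq_sq₀ (norm_nonneg _) (by positivity), EuclideanSpace.real_norm_sq_eq]
  simp [hopf, Fin.sum_univ_succ]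
  ring

theorem hopf_smul (r : ℝ) (u : Fin 4 → ℝ) : hopf (r • u) = r ^ 2 • hopf u := by
  ext i
  fin_cases i <;> simp [hopf] <;> ring

theorem hopf_quatMulRight (h u : Fin 4 → ℝ) :
    hopf ((quatMulRight h).toLin' u) = eulerRodrigues u (hopf h) := by
  ext i
  fin_cases i <;>
  simp [hopf, eulerRodrigues, quatMulRight, Matrix.toLpLin_apply, Matrix.mulVec, dotProduct,
    Fin.sum_univ_succ] <;> ring

theorem sum_sq_quatMulRight (h u : Fin 4 → ℝ) :
    ∑ i, (quatMulRight h).toLin' u i ^ 2 = (∑ i, u i ^ 2) * ∑ i, h i ^ 2 := by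
  simp [quatMulRight, Matrix.mulVec, dotProduct, Fin.sum_univ_succ]
  ring

theorem measurePreserving_quatMulRight {h : Fin 4 → ℝ} (hh : ∑ i, h i ^ 2 = 1) :
    MeasurePreserving (quatMulRight h).toLin' := by
  have hmul : (quatMulRight h).transpose * quatMulRight h = 1 := by
    simp only [Fin.sum_univ_four] at hh
    ext i j
    fin_cases i <;> fin_cases j <;>
    simp [quatMulRight, Matrix.mul_apply, Fin.sum_univ_succ] <;> linarith
  have hdet : (quatMulRight h).det * (quatMulRight h).det = 1 := by
    rw [← Matrix.det_one (n := Fin 4) (R := ℝ), ← hmul, Matrix.det_mul, Matrix.det_transpose]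
  refine ⟨(LinearMap.continuous_of_finiteDimensional _).measurable, ?_⟩
  rw [Real.map_matrix_volume_pi_eq_smul_volume_pi (left_ne_zero_of_mul_eq_one hdet)]
  have : |(quatMulRight h).det⁻¹| = 1 := by
    rcases mul_self_eq_one_iff.1 hdet with h | h <;> simp [h]
  simp [this]

theorem exists_hopf_eq {y : EuclideanSpace ℝ (Fin 3)} (hy : ‖y‖ = 1) :
    ∃ h : Fin 4 → ℝ, ∑ i, h i ^ 2 = 1 ∧ hopf h = y := by
  suffices ∃ h, hopf h = y by
    obtain ⟨h, rfl⟩ := this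
    exact ⟨h, by rw [← norm_hopf, hy], rfl⟩
  have hsq : y 0 ^ 2 + y 1 ^ 2 + y 2 ^ 2 = 1 := by
    have := EuclideanSpace.real_norm_sq_eq y
    rw [hy, Fin.sum_univ_three] at this
    linarith
  by_cases h0 : y 0 = -1
  · have h1 : y 1 = 0 := by nlinarith [sq_nonneg (y 1), sq_nonneg (y 2)]
    have h2 : y 2 = 0 := by nlinarith [sq_nonneg (y 1), sq_nonneg (y 2)]
    refine ⟨![0, 0, 0, 1], ?_⟩
    ext i
    fin_cases i <;> simp [hopf, h0, h1, h2]
  · have hpos : 0 < (1 + y 0) / 2 := by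
      have : -1 ≤ y 0 := by nlinarith [sq_nonneg (y 1), sq_nonneg (y 2)]
      have := lt_of_le_of_ne this (Ne.symm h0)
      linarith
    obtain ⟨p, hp, hp2⟩ : ∃ p : ℝ, 0 < p ∧ p ^ 2 = (1 + y 0) / 2 :=
      ⟨√_, Real.sqrt_pos.2 hpos, Real.sq_sqrt hpos.le⟩
    refine ⟨![p, 0, -(y 2 / (2 * p)), y 1 / (2 * p)], ?_⟩
    ext i
    fin_cases i
    · simp [hopf]
      field_simp
      have : p ^ 4 = ((1 + y 0) / 2) ^ 2 := by rw [← hp2]; ring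
      nlinarith
    · simp [hopf]
      field_simp
    · simp [hopf]
      field_simp

/-- The extension of a function on the unit sphere to a function that is homogeneous of degree
zero. -/
noncomputable def radialExt (f : EuclideanSpace ℝ (Fin 3) → ℝ) (y : EuclideanSpace ℝ (Fin 3)) : ℝ :=
  f (‖y‖⁻¹ • y)

section RadialExt

variable {f : EuclideanSpace ℝ (Fin 3) → ℝ}

theorem radialExt_smul (f : EuclideanSpace ℝ (Fin 3) → ℝ) {r : ℝ} (hr : 0 < r)
    (y : EuclideanSpace ℝ (Fin 3)) : radialExt f (r • y) = radialExt f y := by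
  unfold radialExt
  rw [norm_smul, Real.norm_of_nonneg hr.le, smul_smul]
  congr 2
  field_simp

theorem measurable_radialExt (hf : Continuous f) : Measurable (radialExt f) :=
  hf.measurable.comp (measurable_norm.inv.smul measurable_id)

theorem continuousAt_radialExt (hf : Continuous f) {y : EuclideanSpace ℝ (Fin 3)} (hy : y ≠ 0) :
    ContinuousAt (radialExt f) y :=
  hf.continuousAt.comp ((continuous_norm.continuousAt.inv₀ (norm_ne_zero_iff.2 hy)).smul
    continuousAt_id)

theorem exists_abs_radialExt_le (hf : Continuous f) : ∃ M, ∀ y, |radialExt f y| ≤ M := by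
  obtain ⟨M, hM⟩ := (isCompact_closedBall (0 : EuclideanSpace ℝ (Fin 3)) 1).exists_bound_of_continuousOn
    hf.continuousOn
  refine ⟨M, fun y => hM _ ?_⟩
  rw [mem_closedBall_zero_iff, norm_smul, norm_inv, norm_norm]
  exact inv_mul_le_one

theorem setIntegral_ball_comp_isometry
    (e : EuclideanSpace ℝ (Fin 3) ≃ₗᵢ[ℝ] EuclideanSpace ℝ (Fin 3))
    (g : EuclideanSpace ℝ (Fin 3) → ℝ) :
    ∫ x in Metric.ball 0 1, g (e x) = ∫ x in Metric.ball 0 1, g x := by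
  rw [← e.measurePreserving.setIntegral_preimage_emb e.toHomeomorph.measurableEmbedding g]
  congr 2
  ext x
  simp

theorem integral_radialExt_eulerRodrigues (f : EuclideanSpace ℝ (Fin 3) → ℝ) {u : Fin 4 → ℝ} (hu : u ≠ 0) :
    ∫ x in Metric.ball 0 1, radialExt f (eulerRodrigues u x) =
      ∫ x in Metric.ball 0 1, radialExt f x := by
  have hs : 0 < ∑ i, u i ^ 2 := by
    obtain ⟨i, hi⟩ := Function.ne_iff.1 hu
    exact Finset.sum_pos' (fun _ _ => sq_nonneg _) ⟨i, Finset.mem_univ _, by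
      have : u i ≠ 0 := hi
      positivity⟩
  set s := ∑ i, u i ^ 2
  let e : EuclideanSpace ℝ (Fin 3) →ₗᵢ[ℝ] EuclideanSpace ℝ (Fin 3) :=
    { toLinearMap := s⁻¹ • eulerRodrigues u
      norm_map' := fun x => by
        rw [LinearMap.smul_apply, norm_smul, norm_eulerRodrigues,
          Real.norm_of_nonneg (inv_nonneg.2 hs.le)]
        field_simp
        rfl }
  let e' := e.toLinearIsometryEquiv rfl
  have he : ∀ x, e' x = s⁻¹ • eulerRodrigues u x := fun x => rfl
  rw [← setIntegral_ball_comp_isometry e' (radialExt f)]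
  simp_rw [he, radialExt_smul f (inv_pos.2 hs)]

theorem integral_radialExt_eulerRodrigues_right (f : EuclideanSpace ℝ (Fin 3) → ℝ)
    {x : EuclideanSpace ℝ (Fin 3)} (hx : x ≠ 0) :
    ∫ u in {u : Fin 4 → ℝ | ∑ i, u i ^ 2 ≤ 1}, radialExt f (eulerRodrigues u x) =
      ∫ u in {u : Fin 4 → ℝ | ∑ i, u i ^ 2 ≤ 1}, radialExt f (hopf u) := by
  have hx' : 0 < ‖x‖ := norm_pos_iff.2 hx
  obtain ⟨h, hh, hhx⟩ := exists_hopf_eq (y := ‖x‖⁻¹ • x) (by rw [norm_smul]; simp [hx])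
  have hdet : (quatMulRight h).toLin'.det ≠ 0 := by
    intro h0
    have hinj : Function.Injective (quatMulRight h).toLin' := by
      rw [injective_iff_map_eq_zero]
      intro u hu
      have h1 := sum_sq_quatMulRight h u
      rw [hu, hh] at h1
      simp only [Pi.zero_apply, ne_eq, OfNat.ofNat_ne_zero, not_false_eq_true, zero_pow,
        Finset.sum_const_zero, mul_one] at h1
      ext i
      have := (Finset.sum_eq_zero_iff_of_nonneg fun i _ => sq_nonneg (u i)).1 h1.symm i
        (Finset.mem_univ i)
      simpa using this
    exact (LinearMap.isUnit_iff_ker_eq_bot _).2 (LinearMap.ker_eq_bot.2 hinj) |>.map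
      (LinearMap.det : _ →* ℝ) |>.ne_zero h0
  have hemb : MeasurableEmbedding (quatMulRight h).toLin' :=
    ((LinearEquiv.ofIsUnitDet (v := Pi.basisFun ℝ (Fin 4)) (v' := Pi.basisFun ℝ (Fin 4))
      (f := (quatMulRight h).toLin') (by simpa using hdet)).toContinuousLinearEquiv).toHomeomorph.measurableEmbedding
  have := (measurePreserving_quatMulRight hh).setIntegral_preimage_emb hemb
    (fun u => radialExt f (hopf u)) {u : Fin 4 → ℝ | ∑ i, u i ^ 2 ≤ 1}
  have hpre : (quatMulRight h).toLin' ⁻¹' {u : Fin 4 → ℝ | ∑ i, u i ^ 2 ≤ 1} =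
      {u : Fin 4 → ℝ | ∑ i, u i ^ 2 ≤ 1} := by
    ext u
    rw [Set.mem_preimage, Set.mem_ofPred_eq, sum_sq_quatMulRight, hh, mul_one, Set.mem_ofPred_eq]
  rw [hpre] at this
  rw [← this]
  simp_rw [hopf_quatMulRight, hhx, map_smul, radialExt_smul f (inv_pos.2 hx')]

/-- The Hopf map sends the uniform measure on the unit ball of `ℝ⁴` to a measure whose radial
projection is uniform on the sphere. -/
theorem volume_ball_mul_integral_hopf (hf : Continuous f) :
    volume.real (Metric.ball (0 : EuclideanSpace ℝ (Fin 3)) 1) *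
        ∫ u in {u : Fin 4 → ℝ | ∑ i, u i ^ 2 ≤ 1}, radialExt f (hopf u) =
      volume.real {u : Fin 4 → ℝ | ∑ i, u i ^ 2 ≤ 1} *
        ∫ x in Metric.ball 0 1, radialExt f x := by
  obtain ⟨M, hM⟩ := exists_abs_radialExt_le hf
  have hfin : IsFiniteMeasure (volume.restrict {v : Fin 4 → ℝ | ∑ i, v i ^ 2 ≤ 1}) :=
    ⟨by simpa using (isBounded_sum_sq_le 1).measure_lt_top⟩
  have hfin' : IsFiniteMeasure
      (volume.restrict (Metric.ball (0 : EuclideanSpace ℝ (Fin 3)) 1)) :=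
    ⟨by simp⟩
  have hcont : Continuous fun p : (Fin 4 → ℝ) × EuclideanSpace ℝ (Fin 3) =>
      eulerRodrigues p.1 p.2 := by
    simp only [eulerRodrigues, Matrix.toLpLin_apply]
    refine (PiLp.continuous_toLp 2 _).comp (Continuous.matrix_mulVec ?_ (by fun_prop))
    refine continuous_matrix fun i j => ?_
    fin_cases i <;> fin_cases j <;> simp <;> fun_prop
  have hint : Integrable (Function.uncurry fun (u : Fin 4 → ℝ) (x : EuclideanSpace ℝ (Fin 3)) =>
      radialExt f (eulerRodrigues u x))
      ((volume.restrict {v : Fin 4 → ℝ | ∑ i, v i ^ 2 ≤ 1}).prod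
        (volume.restrict (Metric.ball (0 : EuclideanSpace ℝ (Fin 3)) 1))) :=
    Integrable.of_bound (C := M)
      ((measurable_radialExt hf).comp hcont.measurable).aestronglyMeasurable
      (Eventually.of_forall fun p => hM _)
  have hswap := integral_integral_swap hint
  have h1 : ∫ u in {u : Fin 4 → ℝ | ∑ i, u i ^ 2 ≤ 1}, ∫ x in Metric.ball 0 1,
      radialExt f (eulerRodrigues u x) = ∫ u in {u : Fin 4 → ℝ | ∑ i, u i ^ 2 ≤ 1},
        ∫ x in Metric.ball 0 1, radialExt f x := by
    refine integral_congr_ae (ae_restrict_of_ae ?_)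
    filter_upwards [Measure.ae_ne volume 0] with u hu
    exact integral_radialExt_eulerRodrigues f hu
  have h2 : ∫ x in Metric.ball (0 : EuclideanSpace ℝ (Fin 3)) 1,
      ∫ u in {u : Fin 4 → ℝ | ∑ i, u i ^ 2 ≤ 1}, radialExt f (eulerRodrigues u x) =
      ∫ x in Metric.ball (0 : EuclideanSpace ℝ (Fin 3)) 1,
        ∫ u in {u : Fin 4 → ℝ | ∑ i, u i ^ 2 ≤ 1}, radialExt f (hopf u) := by
    refine integral_congr_ae (ae_restrict_of_ae ?_)
    filter_upwards [Measure.ae_ne volume 0] with x hx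
    exact integral_radialExt_eulerRodrigues_right f hx
  rw [h1, h2] at hswap
  simpa using hswap.symm

theorem map_toSphere :
    (volume : Measure (EuclideanSpace ℝ (Fin 3))).toSphere.map (↑) =
      (3 : ENNReal) • (volume.restrict (Metric.ball (0 : EuclideanSpace ℝ (Fin 3)) 1 \ {0})).map
        fun x => ‖x‖⁻¹ • x := by
  have hm : Measurable fun x : EuclideanSpace ℝ (Fin 3) => ‖x‖⁻¹ • x :=
    measurable_norm.inv.smul measurable_id
  ext s hs
  rw [Measure.map_apply measurable_subtype_coe hs,
    Measure.toSphere_apply' _ (measurable_subtype_coe hs), Measure.smul_apply,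
    Measure.map_apply hm hs, Measure.restrict_apply (hm hs), Subtype.image_preimage_coe,
    finrank_euclideanSpace_fin, smul_eq_mul, Nat.cast_ofNat]
  congr 2
  ext x
  constructor
  · rintro ⟨r, ⟨hr0, hr1⟩, y, ⟨hy, hys⟩, rfl⟩
    have hy1 : ‖y‖ = 1 := by simpa using hy
    have hr : ‖r • y‖ = r := by rw [norm_smul, hy1, mul_one, Real.norm_of_nonneg hr0.le]
    refine ⟨?_, ?_, ?_⟩
    · change ‖r • y‖⁻¹ • r • y ∈ s
      rwa [hr, inv_smul_smul₀ hr0.ne']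
    · rwa [mem_ball_zero_iff, hr]
    · change r • y ≠ 0
      rw [← norm_ne_zero_iff, hr]
      exact hr0.ne'
  · rintro ⟨hxs, hx1, hx0⟩
    have hx : 0 < ‖x‖ := norm_pos_iff.2 hx0
    exact ⟨‖x‖, ⟨hx, by simpa using hx1⟩, ‖x‖⁻¹ • x,
      ⟨by simp [norm_smul, hx.ne'], hxs⟩, smul_inv_smul₀ hx.ne' x⟩

theorem integral_toSphere_eq (hf : Continuous f) :
    ∫ u : Metric.sphere (0 : EuclideanSpace ℝ (Fin 3)) 1, f u
        ∂((volume : Measure (EuclideanSpace ℝ (Fin 3))).toSphere) =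
      3 * ∫ x in Metric.ball 0 1, radialExt f x := by
  have hm : Measurable fun x : EuclideanSpace ℝ (Fin 3) => ‖x‖⁻¹ • x :=
    measurable_norm.inv.smul measurable_id
  rw [← integral_map (φ := ((↑) : Metric.sphere (0 : EuclideanSpace ℝ (Fin 3)) 1 → _))
      measurable_subtype_coe.aemeasurable hf.aestronglyMeasurable,
    map_toSphere, integral_smul_measure, integral_map hm.aemeasurable hf.aestronglyMeasurable,
    setIntegral_congr_set (sdiff_null_ae_eq_self (measure_singleton _))]
  simp [radialExt]

end RadialExt

/-- A signed primitive Pythagorean quadruple with positive hypotenuse. -/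
def IsPrimitiveQuad (q : ℤ × ℤ × ℤ × ℤ) : Prop :=
  0 < q.2.2.2 ∧ q.1 ^ 2 + q.2.1 ^ 2 + q.2.2.1 ^ 2 = q.2.2.2 ^ 2 ∧
    Int.gcd q.1 (Int.gcd q.2.1 (Int.gcd q.2.2.1 q.2.2.2 : ℤ) : ℤ) = 1

/-- The quadruple with hypotenuse `|α|² + |β|²` given by the Hopf map. -/
def pairQuad (v : GaussianInt × GaussianInt) : ℤ × ℤ × ℤ × ℤ :=
  (v.1.norm - v.2.norm, 2 * (v.1 * star v.2).re, 2 * (v.1 * star v.2).im, pairNorm v)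

theorem exists_combination_eq_gcd (x y z t : ℤ) : ∃ a b c d : ℤ,
    a * x + b * y + c * z + d * t = Int.gcd x (Int.gcd y (Int.gcd z t : ℤ) : ℤ) := by
  obtain ⟨a, b, h1⟩ : ∃ a b, _ = x * a + _ * b := ⟨_, _, Int.gcd_eq_gcd_ab x _⟩
  obtain ⟨c, d, h2⟩ : ∃ c d, _ = y * c + _ * d := ⟨_, _, Int.gcd_eq_gcd_ab y (Int.gcd z t)⟩
  obtain ⟨e, f, h3⟩ : ∃ e f, _ = z * e + _ * f := ⟨_, _, Int.gcd_eq_gcd_ab z t⟩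
  exact ⟨a, b * c, b * d * e, b * d * f, by rw [h1, h2, h3]; ring⟩

theorem gcd_eq_one_of_combination {x y z t a b c d : ℤ}
    (h : a * x + b * y + c * z + d * t = 1) :
    Int.gcd x (Int.gcd y (Int.gcd z t : ℤ) : ℤ) = 1 := by
  set g₁ : ℤ := (Int.gcd z t : ℤ)
  set g₂ : ℤ := (Int.gcd y g₁ : ℤ)
  have h3 : (Int.gcd x g₂ : ℤ) ∣ g₂ := Int.gcd_dvd_right _ _
  have h2 : g₂ ∣ g₁ := Int.gcd_dvd_right _ _
  have hd : (Int.gcd x g₂ : ℤ) ∣ 1 := by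
    rw [← h]
    exact ((((Int.gcd_dvd_left _ _).mul_left _).add
      ((h3.trans (Int.gcd_dvd_left _ _)).mul_left _)).add
      (((h3.trans h2).trans (Int.gcd_dvd_left _ _)).mul_left _)).add
      (((h3.trans h2).trans (Int.gcd_dvd_right _ _)).mul_left _)
  exact_mod_cast Int.eq_one_of_dvd_one (Int.natCast_nonneg _) hd

namespace IsPrimitiveQuad

variable {x y z t : ℤ}

theorem exists_combination (h : IsPrimitiveQuad (x, y, z, t)) :
    ∃ a b c d : ℤ, a * x + b * y + c * z + d * t = 1 := by
  obtain ⟨a, b, c, d, h'⟩ := exists_combination_eq_gcd x y z t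
  exact ⟨a, b, c, d, by rw [h', h.2.2, Nat.cast_one]⟩

theorem parity (h : IsPrimitiveQuad (x, y, z, t)) :
    Odd x ∧ Even y ∧ Even z ∧ Odd t ∨ Even x ∧ Odd y ∧ Even z ∧ Odd t ∨
      Even x ∧ Even y ∧ Odd z ∧ Odd t := by
  have hsq : ∀ n : ℤ, Even n ∧ n ^ 2 % 4 = 0 ∨ Odd n ∧ n ^ 2 % 4 = 1 := fun n => by
    rcases Int.even_or_odd n with hn | hn
    · refine .inl ⟨hn, ?_⟩
      obtain ⟨k, rfl⟩ := hn
      ring_nf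
      omega
    · exact .inr ⟨hn, Int.sq_mod_four_eq_one_of_odd hn⟩
  obtain ⟨a, b, c, d, h1⟩ := h.exists_combination
  have hx := hsq x
  have hy := hsq y
  have hz := hsq z
  have ht := hsq t
  have h2 : x ^ 2 + y ^ 2 + z ^ 2 = t ^ 2 := h.2.1
  generalize x ^ 2 = X at *
  generalize y ^ 2 = Y at *
  generalize z ^ 2 = Z at *
  generalize t ^ 2 = T at *
  by_cases hall : Even x ∧ Even y ∧ Even z ∧ Even t
  · have : Even (1 : ℤ) := by
      rw [← h1]
      simp [hall, parity_simps]
    simp at this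
  · grind

end IsPrimitiveQuad

theorem norm_mul_self_star (α : GaussianInt) : ((α.norm : ℤ) : GaussianInt) = α * star α :=
  Zsqrtd.norm_eq_mul_conj α

theorem pairQuad_sq (v : GaussianInt × GaussianInt) :
    (pairQuad v).1 ^ 2 + (pairQuad v).2.1 ^ 2 + (pairQuad v).2.2.1 ^ 2 =
      (pairQuad v).2.2.2 ^ 2 := by
  simp [pairQuad, pairNorm, Zsqrtd.norm_def]
  ring

theorem pairQuad_mul (δ α β : GaussianInt) :
    pairQuad (δ * α, δ * β) = δ.norm • pairQuad (α, β) := by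
  simp [pairQuad, pairNorm, Zsqrtd.norm_def]
  refine ⟨?_, ?_, ?_, ?_⟩ <;> ring

theorem IsPrimitiveQuad.exists_pairQuad_eq {q : ℤ × ℤ × ℤ × ℤ} (hq : IsPrimitiveQuad q)
    (hodd : Odd q.1) : ∃ v, pairQuad v = q := by
  obtain ⟨x, y, z, t⟩ := q
  obtain ⟨hxo, ⟨y, rfl⟩, ⟨z, rfl⟩, hto⟩ : Odd x ∧ Even y ∧ Even z ∧ Odd t := by
    rcases hq.parity with h | h | h
    · exact h
    · exact absurd h.1 (Int.not_even_iff_odd.2 hodd)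
    · exact absurd h.1 (Int.not_even_iff_odd.2 hodd)
  obtain ⟨a, ha⟩ := hto.add_odd hxo
  obtain ⟨b, hb⟩ := hto.sub_odd hxo
  obtain rfl : t = a + b := by linarith
  obtain rfl : x = a - b := by linarith
  have hpos : 0 < a + b := hq.1
  have heq : (a - b) ^ 2 + (y + y) ^ 2 + (z + z) ^ 2 = (a + b) ^ 2 := hq.2.1
  have hab : y * y + z * z = a * b := by linarith
  have ha0 : 0 ≤ a := by
    by_contra! h
    nlinarith [mul_self_nonneg y, mul_self_nonneg z]
  have hb0 : 0 ≤ b := by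
    by_contra! h
    nlinarith [mul_self_nonneg y, mul_self_nonneg z]
  obtain ⟨A, B, C, D, h1⟩ := hq.exists_combination
  rcases ha0.eq_or_lt with rfl | ha1
  · have hy : y = 0 := by nlinarith [mul_self_nonneg y, mul_self_nonneg z]
    have hz : z = 0 := by nlinarith [mul_self_nonneg y, mul_self_nonneg z]
    subst hy hz
    have : b ∣ 1 := ⟨D - A, by linarith⟩
    obtain rfl : b = 1 := Int.eq_one_of_dvd_one hb0 this
    exact ⟨(0, 1), by simp [pairQuad, pairNorm]⟩
  set w : GaussianInt := ⟨y, z⟩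
  have hw : w * star w = a * b := by
    ext <;> simp [w] <;> linarith
  set g := EuclideanDomain.gcd (a : GaussianInt) w
  have hga : g ∣ a := EuclideanDomain.gcd_dvd_left _ _
  have hgw : g ∣ w := EuclideanDomain.gcd_dvd_right _ _
  have hga' : star g ∣ a := by
    have := map_dvd (starRingEnd GaussianInt) hga
    rwa [map_intCast] at this
  have hgw' : star g ∣ star w := map_dvd (starRingEnd GaussianInt) hgw
  have hone : (1 : GaussianInt) = ((A + D : ℤ) : GaussianInt) * a + ((D - A : ℤ) : GaussianInt) * b +
      (⟨B, -C⟩ : GaussianInt) * w + (⟨B, C⟩ : GaussianInt) * star w := by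
    ext
    · simp [w]
      linarith
    · simp [w]
      ring
  have hnorm : g.norm = a := by
    refine Int.dvd_antisymm (GaussianInt.norm_nonneg g) ha0 ?_ ?_
    · rw [← Zsqrtd.intCast_dvd_intCast (d := -1), norm_mul_self_star]
      have : (a : GaussianInt) = ((A + D : ℤ) : GaussianInt) * (a * a) +
          ((D - A : ℤ) : GaussianInt) * (w * star w) + (⟨B, -C⟩ : GaussianInt) * (w * a) +
          (⟨B, C⟩ : GaussianInt) * (a * star w) := by
        rw [hw]
        linear_combination (a : GaussianInt) * hone
      rw [this]
      have h1 := mul_dvd_mul hga hga'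
      have h2 := mul_dvd_mul hgw hgw'
      have h3 := mul_dvd_mul hgw hga'
      have h4 := mul_dvd_mul hga hgw'
      exact (((h1.mul_left _).add (h2.mul_left _)).add (h3.mul_left _)).add (h4.mul_left _)
    · rw [← Zsqrtd.intCast_dvd_intCast (d := -1), norm_mul_self_star]
      obtain ⟨u, v, huv⟩ : ∃ u v, g = a * u + w * v := ⟨_, _, EuclideanDomain.gcd_eq_gcd_ab _ _⟩
      rw [huv]
      refine ⟨u * (a * star u + star w * star v) + v * w * star u + v * star v * b, ?_⟩
      simp only [star_add, star_mul', star_intCast]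
      linear_combination (v * star v) * hw
  obtain ⟨β, hβ⟩ := hgw
  have hβn : β.norm = b := by
    have h1 := congrArg Zsqrtd.norm hβ
    rw [Zsqrtd.norm_mul, hnorm] at h1
    have h2 : w.norm = a * b := by
      rw [← hab]; simp [w, Zsqrtd.norm_def]
    exact mul_left_cancel₀ ha1.ne' (h1.symm.trans h2)
  refine ⟨(g, star β), ?_⟩
  simp only [pairQuad, pairNorm, star_star, ← hβ, Zsqrtd.norm_conj, hnorm, hβn]
  simp [w, two_mul]

/-- Two pairs of Gaussian integers with proportional quadruples are proportional. -/
theorem exists_mul_eq_of_pairQuad_eq_smul {α β α₀ β₀ : GaussianInt} {s : ℤ}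
    (h0 : IsPrimitiveQuad (pairQuad (α₀, β₀)))
    (h : pairQuad (α, β) = s • pairQuad (α₀, β₀)) : ∃ δ, α = δ * α₀ ∧ β = δ * β₀ := by
  obtain ⟨a, b, c, d, h1⟩ := h0.exists_combination
  simp only [pairQuad, pairNorm, Prod.smul_mk, Prod.mk.injEq, smul_eq_mul] at h h1
  obtain ⟨hx, hy, hz, ht⟩ := h
  have hα : α * star α = s * (α₀ * star α₀) := by
    rw [← norm_mul_self_star, ← norm_mul_self_star]
    norm_cast
    linarith
  have hβ : β * star β = s * (β₀ * star β₀) := by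
    rw [← norm_mul_self_star, ← norm_mul_self_star]
    norm_cast
    linarith
  have hαβ : α * star β = s * (α₀ * star β₀) := by
    ext
    · simp at hy ⊢; linarith
    · simp at hz ⊢; linarith
  have hβα : star α * β = s * (star α₀ * β₀) := by
    have := congrArg star hαβ
    simpa [star_mul', mul_comm] using this
  have hcross : α * β₀ - β * α₀ = 0 := by
    rw [← GaussianInt.norm_eq_zero, ← Int.cast_inj (α := GaussianInt), norm_mul_self_star]
    simp only [star_sub, star_mul']
    push_cast
    linear_combination β₀ * star β₀ * hα + α₀ * star α₀ * hβ - β₀ * star α₀ * hαβ -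
      star β₀ * α₀ * hβα
  obtain ⟨u, v, huv⟩ : ∃ u v, u * α₀ + v * β₀ = 1 := by
    refine ⟨((a + d : ℤ) : GaussianInt) * star α₀ + (⟨b, -c⟩ : GaussianInt) * star β₀,
      ((d - a : ℤ) : GaussianInt) * star β₀ + (⟨b, c⟩ : GaussianInt) * star α₀, ?_⟩
    ext
    · simp [Zsqrtd.norm_def] at h1 ⊢
      linarith
    · simp
      ring
  refine ⟨u * α + v * β, ?_, ?_⟩
  · linear_combination (-α) * huv + v * hcross
  · linear_combination (-β) * huv - u * hcross

theorem exists_smul_primitive {q : ℤ × ℤ × ℤ × ℤ} (hpos : 0 < q.2.2.2)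
    (hsq : q.1 ^ 2 + q.2.1 ^ 2 + q.2.2.1 ^ 2 = q.2.2.2 ^ 2) :
    ∃ s : ℤ, ∃ q₀, 0 < s ∧ IsPrimitiveQuad q₀ ∧ q = s • q₀ := by
  obtain ⟨x, y, z, t⟩ := q
  obtain ⟨a, b, c, d, h⟩ := exists_combination_eq_gcd x y z t
  set g₁ : ℤ := (Int.gcd z t : ℤ)
  set g₂ : ℤ := (Int.gcd y g₁ : ℤ)
  set g : ℤ := (Int.gcd x g₂ : ℤ)
  have hg0 : 0 ≤ g := Int.natCast_nonneg _
  have h3 : g ∣ g₂ := Int.gcd_dvd_right _ _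
  have h2 : g₂ ∣ g₁ := Int.gcd_dvd_right _ _
  obtain ⟨x', hx⟩ : g ∣ x := Int.gcd_dvd_left _ _
  obtain ⟨y', hy⟩ : g ∣ y := h3.trans (Int.gcd_dvd_left _ _)
  obtain ⟨z', hz⟩ : g ∣ z := (h3.trans h2).trans (Int.gcd_dvd_left _ _)
  obtain ⟨t', ht⟩ : g ∣ t := (h3.trans h2).trans (Int.gcd_dvd_right _ _)
  clear_value g
  clear h2 h3
  clear_value g₂
  clear_value g₁
  subst hx hy hz ht
  dsimp only at hpos hsq
  have hg : 0 < g := hg0.lt_of_ne (by rintro rfl; simp at hpos)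
  refine ⟨g, (x', y', z', t'), hg, ⟨pos_of_mul_pos_right hpos hg0, ?_, ?_⟩, rfl⟩
  · exact mul_left_cancel₀ (pow_ne_zero 2 hg.ne') (by linear_combination hsq)
  · exact gcd_eq_one_of_combination (a := a) (b := b) (c := c) (d := d)
      (mul_left_cancel₀ hg.ne' (by linear_combination h))

/-- The primitive quadruples whose first coordinate is odd. -/
abbrev OddQuad := {q : ℤ × ℤ × ℤ × ℤ // IsPrimitiveQuad q ∧ Odd q.1}

/-- A pair of Gaussian integers representing a quadruple. -/
noncomputable def quadPair (q : OddQuad) : GaussianInt × GaussianInt :=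
  (q.2.1.exists_pairQuad_eq q.2.2).choose

theorem pairQuad_quadPair (q : OddQuad) : pairQuad (quadPair q) = q :=
  (q.2.1.exists_pairQuad_eq q.2.2).choose_spec

theorem IsPrimitiveQuad.eq_of_smul_eq_smul {q q' : ℤ × ℤ × ℤ × ℤ} (hq : IsPrimitiveQuad q)
    (hq' : IsPrimitiveQuad q') {s s' : ℤ} (hs : 0 < s) (hs' : 0 < s') (h : s • q = s' • q') :
    q = q' := by
  obtain ⟨x, y, z, t⟩ := q
  obtain ⟨x', y', z', t'⟩ := q'
  obtain ⟨a, b, c, d, h1⟩ := hq.exists_combination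
  obtain ⟨a', b', c', d', h1'⟩ := hq'.exists_combination
  simp only [Prod.smul_mk, Prod.mk.injEq, smul_eq_mul] at h
  obtain ⟨hx, hy, hz, ht⟩ := h
  obtain rfl : s = s' := by
    refine Int.dvd_antisymm hs.le hs'.le ⟨a' * x + b' * y + c' * z + d' * t, ?_⟩
      ⟨a * x' + b * y' + c * z' + d * t', ?_⟩
    · linear_combination -s' * h1' - a' * hx - b' * hy - c' * hz - d' * ht
    · linear_combination -s * h1 + a * hx + b * hy + c * hz + d * ht
  simp_all [hs.ne']

theorem pairNorm_mul_quadPair (δ : GaussianInt) (q : OddQuad) :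
    pairNorm (δ * (quadPair q).1, δ * (quadPair q).2) = δ.norm * q.1.2.2.2 := by
  have h := pairQuad_mul δ (quadPair q).1 (quadPair q).2
  rw [Prod.mk.eta, pairQuad_quadPair] at h
  exact congrArg (fun q : ℤ × ℤ × ℤ × ℤ => q.2.2.2) h

/-- Multiplying the pair that represents a primitive quadruple by a Gaussian integer of odd norm
gives every pair of odd norm exactly once. -/
theorem bijective_mul_quadPair : Function.Bijective
    (fun p : {δ : GaussianInt // Odd δ.norm} × OddQuad =>
      (⟨(p.1 * (quadPair p.2).1, p.1 * (quadPair p.2).2), by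
        have ht : Odd (p.2.1.2.2.2) := by
          rcases p.2.2.1.parity with h | h | h <;> exact h.2.2.2
        rw [pairNorm_mul_quadPair]
        exact p.1.2.mul ht⟩ : {v // Odd (pairNorm v)})) := by
  have hn : ∀ δ : {δ : GaussianInt // Odd δ.norm}, 0 < δ.1.norm := fun δ =>
    (GaussianInt.norm_nonneg _).lt_of_ne fun h => by simpa [← h] using δ.2
  constructor
  · rintro ⟨δ, q⟩ ⟨δ', q'⟩ h
    simp only [Subtype.mk.injEq] at h
    have h' := congrArg pairQuad h
    rw [pairQuad_mul, pairQuad_mul, Prod.mk.eta, Prod.mk.eta, pairQuad_quadPair,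
      pairQuad_quadPair] at h'
    obtain rfl : q = q' := Subtype.ext (q.2.1.eq_of_smul_eq_smul q'.2.1 (hn δ) (hn δ') h')
    have hv : quadPair q ≠ 0 := fun h0 => by
      have := q.2.1.1
      rw [← pairQuad_quadPair, h0] at this
      simp [pairQuad, pairNorm] at this
    rw [Prod.mk.injEq] at h
    congr 1
    ext1
    by_contra hne
    refine hv (Prod.ext ?_ ?_)
    · simpa [hne] using h.1
    · simpa [hne] using h.2
  · rintro ⟨⟨α, β⟩, hodd⟩
    have hpos : 0 < pairNorm (α, β) :=
      (add_nonneg (GaussianInt.norm_nonneg _) (GaussianInt.norm_nonneg _)).lt_of_ne fun h => by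
        change Odd (α.norm + β.norm) at hodd
        simp [← h] at hodd
    obtain ⟨s, q, hs, hq, hsq⟩ := exists_smul_primitive (q := pairQuad (α, β)) hpos
      (pairQuad_sq _)
    have ht : pairNorm (α, β) = s * q.2.2.2 := congrArg (fun q : ℤ × ℤ × ℤ × ℤ => q.2.2.2) hsq
    have hx : α.norm - β.norm = s * q.1 := congrArg (fun q : ℤ × ℤ × ℤ × ℤ => q.1) hsq
    have hxo : Odd (s * q.1) := by
      rw [← hx]
      have : α.norm - β.norm = pairNorm (α, β) - 2 * β.norm := by
        rw [pairNorm]; ring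
      rw [this]
      exact hodd.sub_even (even_two_mul _)
    have hso : Odd s := (Int.odd_mul.1 hxo).1
    let q' : OddQuad := ⟨q, hq, (Int.odd_mul.1 hxo).2⟩
    have hq' : pairQuad ((quadPair q').1, (quadPair q').2) = q := pairQuad_quadPair q'
    obtain ⟨δ, hα, hβ⟩ := exists_mul_eq_of_pairQuad_eq_smul (hq'.symm ▸ hq) (hq'.symm ▸ hsq)
    have hδ : δ.norm = s := by
      rw [hα, hβ, pairQuad_mul, hq'] at hsq
      exact mul_right_cancel₀ hq.1.ne' (congrArg (fun q : ℤ × ℤ × ℤ × ℤ => q.2.2.2) hsq)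
    exact ⟨(⟨δ, hδ ▸ hso⟩, q'), by simp only [← hα, ← hβ]⟩

theorem hasSum_int_one_div_sq : HasSum (fun n : ℤ => 1 / (n : ℝ) ^ 2) (Real.pi ^ 2 / 3) := by
  have h := HasSum.of_nat_of_neg (f := fun n : ℤ => 1 / (n : ℝ) ^ 2)
    (by simpa using hasSum_zeta_two) (by simpa using hasSum_zeta_two)
  have hpi : Real.pi ^ 2 / 3 = Real.pi ^ 2 / 6 + Real.pi ^ 2 / 6 - 1 / ((0 : ℤ) : ℝ) ^ 2 := by
    simp
    ring
  rwa [hpi]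

/-- The weight `|δ|⁻⁴` of a Gaussian integer of odd norm that is not a unit. -/
noncomputable def oddWeight (δ : GaussianInt) : ℝ :=
  if Odd δ.norm ∧ δ.norm ≠ 1 then ((δ.norm : ℝ) ^ 2)⁻¹ else 0

theorem oddWeight_nonneg (δ : GaussianInt) : 0 ≤ oddWeight δ := by
  unfold oddWeight
  split_ifs <;> positivity

theorem oddWeight_le (a b : ℤ) :
    oddWeight ⟨a, b⟩ ≤ 1 / 4 * ((1 / (a : ℝ) ^ 2 + if a = 0 then 4 / 9 else 0) *
      (1 / (b : ℝ) ^ 2 + if b = 0 then 4 / 9 else 0)) := by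
  have haxis : ∀ n : ℤ, Odd (n ^ 2) → n ^ 2 ≠ 1 →
      (((n ^ 2 : ℤ) : ℝ) ^ 2)⁻¹ ≤ 1 / 4 * (1 / (n : ℝ) ^ 2 * (4 / 9)) := fun n ho h1 => by
    have ho' : Odd n := by simpa [Int.odd_pow] using ho
    have h9 : 9 ≤ n ^ 2 := by
      have h3 : 3 ≤ |n| := by
        have h0 : |n| ≠ 1 := fun h => h1 (by rw [← sq_abs, h, one_pow])
        obtain ⟨k, hk⟩ : Odd |n| := odd_abs.2 ho'
        have := abs_nonneg n
        omega
      rw [← sq_abs]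
      nlinarith
    have h9' : (9 : ℝ) ≤ (n : ℝ) ^ 2 := by exact_mod_cast h9
    have hpos : (0 : ℝ) < (n : ℝ) ^ 2 := by linarith
    push_cast
    rw [inv_le_comm₀ (by positivity) (by positivity)]
    have : (1 / 4 * (1 / (n : ℝ) ^ 2 * (4 / 9)))⁻¹ = 9 * (n : ℝ) ^ 2 := by
      field_simp
    rw [this]
    nlinarith
  unfold oddWeight
  split_ifs with h ha hb hb
  · subst ha hb
    simp [Zsqrtd.norm_def] at h
  · subst ha
    have hn : Zsqrtd.norm (⟨0, b⟩ : GaussianInt) = b ^ 2 := by simp [Zsqrtd.norm_def]; ring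
    rw [hn] at h ⊢
    refine (haxis b h.1 h.2).trans_eq ?_
    simp
    ring
  · subst hb
    have hn : Zsqrtd.norm (⟨a, 0⟩ : GaussianInt) = a ^ 2 := by simp [Zsqrtd.norm_def]; ring
    rw [hn] at h ⊢
    refine (haxis a h.1 h.2).trans_eq ?_
    simp
  · have hn : Zsqrtd.norm (⟨a, b⟩ : GaussianInt) = a ^ 2 + b ^ 2 := by
      simp [Zsqrtd.norm_def]; ring
    rw [hn]
    have ha' : (0 : ℝ) < (a : ℝ) ^ 2 := by positivity
    have hb' : (0 : ℝ) < (b : ℝ) ^ 2 := by positivity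
    have : 1 / 4 * ((1 / (a : ℝ) ^ 2 + 0) * (1 / (b : ℝ) ^ 2 + 0)) =
        (4 * ((a : ℝ) ^ 2 * (b : ℝ) ^ 2))⁻¹ := by
      field_simp
      ring
    rw [this]
    push_cast
    gcongr
    nlinarith [sq_nonneg ((a : ℝ) ^ 2 - (b : ℝ) ^ 2)]
  all_goals positivity

theorem summable_oddWeight_and_tsum_lt : Summable oddWeight ∧ ∑' δ, oddWeight δ < 4 := by
  have hc : HasSum (fun n : ℤ => 1 / (n : ℝ) ^ 2 + if n = 0 then (4 / 9 : ℝ) else 0)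
      (Real.pi ^ 2 / 3 + 4 / 9) :=
    hasSum_int_one_div_sq.add (hasSum_ite_eq 0 _)
  have hc0 : ∀ n : ℤ, 0 ≤ 1 / (n : ℝ) ^ 2 + if n = 0 then (4 / 9 : ℝ) else 0 := fun n => by
    split_ifs <;> positivity
  have hprod := (hc.mul hc (hc.summable.mul_of_nonneg hc.summable hc0 hc0)).mul_left (1 / 4)
  let e : ℤ × ℤ ≃ GaussianInt :=
    ⟨fun p => ⟨p.1, p.2⟩, fun δ => (δ.re, δ.im), fun _ => rfl, fun _ => rfl⟩
  have hle : ∀ p, oddWeight (e p) ≤ _ := fun p => oddWeight_le p.1 p.2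
  have hs : Summable (oddWeight ∘ e) :=
    hprod.summable.of_nonneg_of_le (fun _ => oddWeight_nonneg _) hle
  refine ⟨e.summable_iff.1 hs, ?_⟩
  rw [← e.tsum_eq]
  refine (hasSum_le hle hs.hasSum hprod).trans_lt ?_
  have h1 : Real.pi ^ 2 < 9.9225 := by nlinarith [Real.pi_lt_d2, Real.pi_gt_three]
  nlinarith [sq_nonneg Real.pi]

theorem radialExt_hopf_pairVec (f : EuclideanSpace ℝ (Fin 3) → ℝ)
    (v : GaussianInt × GaussianInt) :
    radialExt f (hopf (pairVec v)) = f (pythPoint (pairQuad v)) := by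
  unfold radialExt
  congr 1
  rw [norm_hopf, sum_sq_pairVec]
  ext i
  fin_cases i <;>
  simp [hopf, pairVec, pythPoint, pairQuad, Zsqrtd.norm_def,
    -GaussianInt.intCast_re, -GaussianInt.intCast_im] <;> ring

theorem pythPoint_smul {s : ℤ} (hs : s ≠ 0) (q : ℤ × ℤ × ℤ × ℤ) :
    pythPoint (s • q) = pythPoint q := by
  have : (s : ℝ) ≠ 0 := by exact_mod_cast hs
  ext i
  fin_cases i <;> simp [pythPoint, mul_div_mul_left _ _ this]

/-- The sum of a function over the points given by primitive quadruples with odd first coordinate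
and bounded hypotenuse. -/
noncomputable def oddSum (f : EuclideanSpace ℝ (Fin 3) → ℝ) (x : ℝ) : ℝ :=
  ∑' q : OddQuad, if (q.1.2.2.2 : ℝ) ≤ x then f (pythPoint q) else 0

/-- The sum of a function over the points given by pairs of Gaussian integers of odd bounded
norm. -/
noncomputable def pairSum (f : EuclideanSpace ℝ (Fin 3) → ℝ) (x : ℝ) : ℝ :=
  ∑' v, if Odd (pairNorm v) ∧ (pairNorm v : ℝ) ≤ x then radialExt f (hopf (pairVec v)) else 0

theorem norm_pos_of_odd {δ : GaussianInt} (hδ : Odd δ.norm) : 0 < δ.norm :=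
  (GaussianInt.norm_nonneg _).lt_of_ne fun h => by simp [← h] at hδ

theorem pairSum_eq (f : EuclideanSpace ℝ (Fin 3) → ℝ) (x : ℝ) :
    pairSum f x = ∑' δ : GaussianInt, if Odd δ.norm then oddSum f (x / δ.norm) else 0 := by
  let e := Equiv.ofBijective _ bijective_mul_quadPair
  let F : {v // Odd (pairNorm v)} → ℝ := fun v =>
    if (pairNorm v.1 : ℝ) ≤ x then radialExt f (hopf (pairVec v)) else 0
  have hF : F.support.Finite := by
    refine ((finite_pairNorm_le x).preimage Subtype.val_injective.injOn).subset fun v hv => ?_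
    by_contra h
    exact hv (if_neg h)
  have hval : ∀ p, F (e p) = if (p.2.1.2.2.2 : ℝ) ≤ x / p.1.1.norm then
      f (pythPoint p.2) else 0 := fun ⟨δ, q⟩ => by
    have hδ : (0 : ℝ) < δ.1.norm := by exact_mod_cast norm_pos_of_odd δ.2
    have he : (e (δ, q)).1 = (δ.1 * (quadPair q).1, δ.1 * (quadPair q).2) := rfl
    simp only [F, he, pairNorm_mul_quadPair, radialExt_hopf_pairVec, pairQuad_mul, Prod.mk.eta,
      pairQuad_quadPair, pythPoint_smul (norm_pos_of_odd δ.2).ne', le_div_iff₀' hδ, Int.cast_mul]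
  have hsum : Summable fun p => F (e p) :=
    e.summable_iff.2 (summable_of_hasFiniteSupport hF)
  calc pairSum f x = ∑' v, F v := by
        rw [pairSum, ← tsum_subtype_eq_of_support_subset (s := {v | Odd (pairNorm v)})]
        · refine tsum_congr fun v => ?_
          simp [F, show Odd (pairNorm v.1) from v.2]
        · intro v hv
          by_contra h
          exact hv (if_neg fun h' => h h'.1)
    _ = ∑' p, F (e p) := (e.tsum_eq F).symm
    _ = ∑' δ : {δ : GaussianInt // Odd δ.norm}, oddSum f (x / δ.1.norm) := by
        rw [hsum.tsum_prod]
        simp only [hval, oddSum]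
    _ = _ := by
        rw [← tsum_subtype_eq_of_support_subset (s := {δ : GaussianInt | Odd δ.norm})]
        · refine tsum_congr fun δ => ?_
          simp [show Odd δ.1.norm from δ.2]
        · intro v hv
          by_contra h
          exact hv (if_neg h)

theorem quadPair_injective : Function.Injective quadPair := fun q q' h =>
  Subtype.ext (by rw [← pairQuad_quadPair, h, pairQuad_quadPair])

theorem pairNorm_quadPair (q : OddQuad) : pairNorm (quadPair q) = q.1.2.2.2 :=
  congrArg (fun q : ℤ × ℤ × ℤ × ℤ => q.2.2.2) (pairQuad_quadPair q)

theorem finite_oddQuad_le (x : ℝ) : {q : OddQuad | (q.1.2.2.2 : ℝ) ≤ x}.Finite := by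
  refine ((finite_pairNorm_le x).preimage quadPair_injective.injOn).subset fun q hq => ?_
  simpa [pairNorm_quadPair] using hq

theorem summable_pairSum (f : EuclideanSpace ℝ (Fin 3) → ℝ) (x : ℝ) :
    Summable fun v => if Odd (pairNorm v) ∧ (pairNorm v : ℝ) ≤ x then
      radialExt f (hopf (pairVec v)) else 0 := by
  refine summable_of_hasFiniteSupport ((finite_pairNorm_le x).subset fun v hv => ?_)
  by_contra h
  exact hv (if_neg fun h' => h h'.2)

theorem pairSum_one_mono : Monotone (pairSum fun _ => 1) := fun x y hxy => by
  refine (summable_pairSum _ x).tsum_le_tsum (fun v => ?_) (summable_pairSum _ y)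
  dsimp only [radialExt]
  split_ifs with h h'
  · exact le_rfl
  · exact absurd ⟨h.1, h.2.trans hxy⟩ h'
  · exact zero_le_one
  · exact le_rfl

theorem pairSum_one_nonneg (x : ℝ) : 0 ≤ pairSum (fun _ => 1) x :=
  tsum_nonneg fun v => by
    dsimp only [radialExt]
    split_ifs <;> norm_num

theorem abs_oddSum_le {f : EuclideanSpace ℝ (Fin 3) → ℝ} {M : ℝ} (hM : ∀ y, |radialExt f y| ≤ M)
    (x : ℝ) : |oddSum f x| ≤ M * pairSum (fun _ => 1) x := by
  have hM0 : 0 ≤ M := (abs_nonneg _).trans (hM 0)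
  have hs : Summable fun q : OddQuad =>
      ‖if (q.1.2.2.2 : ℝ) ≤ x then f (pythPoint q) else 0‖ := by
    refine summable_of_hasFiniteSupport ((finite_oddQuad_le x).subset fun q hq => ?_)
    by_contra h
    exact hq (by simp [show ¬ (q.1.2.2.2 : ℝ) ≤ x from h])
  refine (norm_tsum_le_tsum_norm hs).trans ?_
  rw [pairSum, ← tsum_mul_left]
  refine hs.tsum_le_tsum_of_inj quadPair quadPair_injective (fun v _ => ?_) (fun q => ?_)
    ((summable_pairSum _ x).mul_left M)
  · dsimp only [radialExt]
    split_ifs <;> simp [hM0]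
  · have hodd : Odd q.1.2.2.2 := by
      rcases q.2.1.parity with h | h | h <;> exact h.2.2.2
    rw [pairNorm_quadPair]
    simp only [hodd, true_and, radialExt]
    split_ifs
    · rw [← pairQuad_quadPair, ← radialExt_hopf_pairVec f, mul_one]
      exact hM _
    · simp

theorem oddSum_of_lt_one (f : EuclideanSpace ℝ (Fin 3) → ℝ) {x : ℝ} (hx : x < 1) :
    oddSum f x = 0 := by
  refine (tsum_congr fun q => if_neg ?_).trans tsum_zero
  have : (1 : ℝ) ≤ q.1.2.2.2 := by exact_mod_cast Int.add_one_le_of_lt q.2.1.1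
  linarith

theorem tendsto_pairSum {f : EuclideanSpace ℝ (Fin 3) → ℝ} (hf : Continuous f) :
    Tendsto (fun x => pairSum f x / x ^ 2) atTop
      (𝓝 ((∫ u in {u | ∑ i, u i ^ 2 ≤ 1}, radialExt f (hopf u)) / 2)) := by
  have hcont : Continuous hopf := by
    unfold hopf
    fun_prop
  obtain ⟨M, hM⟩ := exists_abs_radialExt_le hf
  refine tendsto_odd_pair_sum ((measurable_radialExt hf).comp hcont.measurable)
    (fun u hu => ?_) (fun u r hr => ?_) fun u => hM (hopf u)
  · refine ContinuousAt.comp (f := hopf) (continuousAt_radialExt hf ?_) hcont.continuousAt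
    rw [← norm_ne_zero_iff, norm_hopf]
    intro h
    refine hu (funext fun i => ?_)
    have := (Finset.sum_eq_zero_iff_of_nonneg fun i _ => sq_nonneg (u i)).1 h i
      (Finset.mem_univ i)
    simpa using this
  · rw [hopf_smul, radialExt_smul f (by positivity)]

theorem exists_abs_oddSum_div_le {f : EuclideanSpace ℝ (Fin 3) → ℝ} (hf : Continuous f) :
    ∃ C, ∀ x, |oddSum f x / x ^ 2| ≤ C := by
  obtain ⟨M, hM⟩ := exists_abs_radialExt_le hf
  have hM0 : 0 ≤ M := (abs_nonneg _).trans (hM 0)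
  set L := (∫ u in {u | ∑ i, u i ^ 2 ≤ 1}, radialExt (fun _ => 1) (hopf u)) / 2
  obtain ⟨x₀, hx₀⟩ := eventually_atTop.1
    ((tendsto_pairSum (f := fun _ => 1) continuous_const).eventually_le_const (lt_add_one L))
  refine ⟨M * |L + 1| + M * pairSum (fun _ => 1) x₀, fun x => ?_⟩
  have hP := pairSum_one_nonneg x₀
  rcases lt_or_ge x 1 with hx | hx
  · rw [oddSum_of_lt_one f hx, zero_div, abs_zero]
    positivity
  · have hx2 : 1 ≤ x ^ 2 := by nlinarith
    have h1 : |oddSum f x / x ^ 2| ≤ M * (pairSum (fun _ => 1) x / x ^ 2) := by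
      rw [abs_div, abs_of_nonneg (sq_nonneg x), ← mul_div_assoc]
      gcongr
      exact abs_oddSum_le hM x
    refine h1.trans ?_
    rcases le_total x₀ x with h | h
    · have := mul_le_mul_of_nonneg_left ((hx₀ x h).trans (le_abs_self _)) hM0
      have : 0 ≤ M * pairSum (fun _ => 1) x₀ := by positivity
      linarith
    · have h2 : pairSum (fun _ => 1) x / x ^ 2 ≤ pairSum (fun _ => 1) x₀ :=
        (div_le_self (pairSum_one_nonneg x) hx2).trans (pairSum_one_mono h)
      have := mul_le_mul_of_nonneg_left h2 hM0
      have : 0 ≤ M * |L + 1| := by positivity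
      linarith

theorem hasSum_norm_eq_one (a : ℝ) :
    HasSum (fun δ : GaussianInt => if δ.norm = 1 then a else 0) (4 * a) := by
  have hset : ∀ δ : GaussianInt, δ.norm = 1 ↔
      δ ∈ ({⟨1, 0⟩, ⟨-1, 0⟩, ⟨0, 1⟩, ⟨0, -1⟩} : Finset GaussianInt) := fun δ => by
    obtain ⟨b, c⟩ := δ
    simp only [Zsqrtd.norm_def, Finset.mem_insert, Finset.mem_singleton, Zsqrtd.mk.injEq]
    constructor
    · intro h
      have hb : b ^ 2 ≤ 1 := by nlinarith [mul_self_nonneg c]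
      have hc : c ^ 2 ≤ 1 := by nlinarith [mul_self_nonneg b]
      have hb1 := abs_le.1 ((sq_le_one_iff_abs_le_one b).1 hb)
      have hc1 := abs_le.1 ((sq_le_one_iff_abs_le_one c).1 hc)
      obtain ⟨hb1, hb2⟩ := hb1
      obtain ⟨hc1, hc2⟩ := hc1
      interval_cases b <;> interval_cases c <;> simp_all
    · rintro (⟨rfl, rfl⟩ | ⟨rfl, rfl⟩ | ⟨rfl, rfl⟩ | ⟨rfl, rfl⟩) <;> norm_num
  simp only [hset]
  set s : Finset GaussianInt := {⟨1, 0⟩, ⟨-1, 0⟩, ⟨0, 1⟩, ⟨0, -1⟩}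
  have h : HasSum (fun δ => if δ ∈ s then a else 0) (∑ δ ∈ s, if δ ∈ s then a else 0) :=
    hasSum_sum_of_ne_finset_zero fun δ hδ => if_neg hδ
  rw [Finset.sum_congr rfl fun δ hδ => if_pos hδ, Finset.sum_const, nsmul_eq_mul] at h
  exact h

theorem pairSum_div_sq {f : EuclideanSpace ℝ (Fin 3) → ℝ} (hf : Continuous f) {x : ℝ}
    (hx : 0 < x) : pairSum f x / x ^ 2 = 4 * (oddSum f x / x ^ 2) +
      ∑' δ, oddWeight δ * (oddSum f (x / (max δ.norm 1 : ℤ)) / (x / (max δ.norm 1 : ℤ)) ^ 2) := by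
  obtain ⟨C, hC⟩ := exists_abs_oddSum_div_le hf
  have h1 := hasSum_norm_eq_one (oddSum f x / x ^ 2)
  have h2 : Summable fun δ => oddWeight δ *
      (oddSum f (x / (max δ.norm 1 : ℤ)) / (x / (max δ.norm 1 : ℤ)) ^ 2) := by
    refine .of_norm_bounded (summable_oddWeight_and_tsum_lt.1.mul_right C) fun δ => ?_
    rw [norm_mul, Real.norm_of_nonneg (oddWeight_nonneg δ)]
    exact mul_le_mul_of_nonneg_left (hC _) (oddWeight_nonneg δ)
  rw [← h1.tsum_eq, ← h1.summable.tsum_add h2, pairSum_eq, ← tsum_div_const]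
  refine tsum_congr fun δ => ?_
  unfold oddWeight
  by_cases ho : Odd δ.norm
  · have hpos := norm_pos_of_odd ho
    have hpos' : (0 : ℝ) < δ.norm := by exact_mod_cast hpos
    rw [max_eq_left hpos]
    by_cases h1 : δ.norm = 1
    · simp [h1]
    · simp only [ho, h1, if_true, if_false, true_and, not_false_eq_true, ne_eq, zero_add]
      field_simp
  · have h1 : δ.norm ≠ 1 := fun h => ho (by rw [h]; exact odd_one)
    simp [ho, h1]

/-- The primitive quadruples with odd first coordinate equidistribute on the sphere. -/
theorem exists_tendsto_oddSum : ∃ κ : ℝ, 0 < κ ∧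
    ∀ f : EuclideanSpace ℝ (Fin 3) → ℝ, Continuous f →
      Tendsto (fun x => oddSum f x / x ^ 2) atTop
        (𝓝 (κ * ∫ x in Metric.ball 0 1, radialExt f x)) := by
  set V := volume.real {u : Fin 4 → ℝ | ∑ i, u i ^ 2 ≤ 1}
  set B := volume.real (Metric.ball (0 : EuclideanSpace ℝ (Fin 3)) 1)
  have hB : 0 < B := by
    refine ENNReal.toReal_pos (Metric.measure_ball_pos _ _ one_pos).ne' measure_ball_lt_top.ne
  have hV : 0 < V := by
    refine ENNReal.toReal_pos ?_ (isBounded_sum_sq_le 1).measure_lt_top.ne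
    refine ((IsOpen.measure_pos (U := {u : Fin 4 → ℝ | ∑ i, u i ^ 2 < 1}) volume
      (isOpen_lt continuous_sum_sq continuous_const) ⟨0, by simp⟩).trans_le
      (measure_mono (Set.ofPred_subset_ofPred.2 fun u hu => hu.le))).ne'
  have hW : 0 ≤ ∑' δ, oddWeight δ := tsum_nonneg oddWeight_nonneg
  refine ⟨V / B / 2 / (4 + ∑' δ, oddWeight δ), by positivity, fun f hf => ?_⟩
  obtain ⟨C, hC⟩ := exists_abs_oddSum_div_le hf
  have h := tendsto_of_tendsto_add_tsum_dilates (φ := fun x => oddSum f x / x ^ 2)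
    (k := fun δ : GaussianInt => ((max δ.norm 1 : ℤ) : ℝ)) oddWeight_nonneg
    summable_oddWeight_and_tsum_lt.1 summable_oddWeight_and_tsum_lt.2
    (fun δ => by exact_mod_cast lt_max_of_lt_right one_pos) hC
    ((tendsto_pairSum hf).congr' ?_)
  · convert h using 2
    have := volume_ball_mul_integral_hopf hf
    rw [mul_comm, ← eq_div_iff hB.ne'] at this
    rw [this]
    field_simp
    exact mul_comm _ _
  · filter_upwards [eventually_gt_atTop 0] with x hx
    exact pairSum_div_sq hf hx

/-- The cyclic permutation of the three legs of a quadruple. -/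
def rotateQuad : (ℤ × ℤ × ℤ × ℤ) ≃ (ℤ × ℤ × ℤ × ℤ) where
  toFun q := (q.2.1, q.2.2.1, q.1, q.2.2.2)
  invFun q := (q.2.2.1, q.1, q.2.1, q.2.2.2)
  left_inv _ := rfl
  right_inv _ := rfl

theorem IsPrimitiveQuad.rotate {q : ℤ × ℤ × ℤ × ℤ} (hq : IsPrimitiveQuad q) :
    IsPrimitiveQuad (rotateQuad q) := by
  obtain ⟨x, y, z, t⟩ := q
  obtain ⟨a, b, c, d, h⟩ := hq.exists_combination
  refine ⟨hq.1, ?_, gcd_eq_one_of_combination (a := b) (b := c) (c := a) (d := d) ?_⟩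
  · have h2 : x ^ 2 + y ^ 2 + z ^ 2 = t ^ 2 := hq.2.1
    change y ^ 2 + z ^ 2 + x ^ 2 = t ^ 2
    linarith
  · change b * y + c * z + a * x + d * t = 1
    linarith

theorem mem_pythQuad_iff {n : ℕ} {q : ℤ × ℤ × ℤ × ℤ} :
    q ∈ PythQuad n ↔ IsPrimitiveQuad q ∧ q.2.2.2 ≤ n := by
  simp only [PythQuad, IsPrimitiveQuad, Set.mem_ofPred_eq, and_assoc]

theorem rotateQuad_mem_iff {n : ℕ} {q : ℤ × ℤ × ℤ × ℤ} :
    q ∈ PythQuad n ↔ rotateQuad q ∈ PythQuad n := by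
  simp only [mem_pythQuad_iff]
  exact ⟨fun h => ⟨h.1.rotate, h.2⟩, fun h => ⟨h.1.rotate.rotate, h.2⟩⟩

theorem finite_pythQuad (n : ℕ) : (PythQuad n).Finite := by
  refine (Set.finite_Icc ((-n, -n, -n, 0) : ℤ × ℤ × ℤ × ℤ) (n, n, n, n)).subset ?_
  rintro ⟨x, y, z, t⟩ ⟨h0, hsq, -, hn⟩
  dsimp only at h0 hsq hn
  have hle : ∀ w : ℤ, w ^ 2 ≤ t ^ 2 → -n ≤ w ∧ w ≤ n := fun w hw => by
    have := abs_le_of_sq_le_sq' hw h0.le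
    constructor <;> linarith
  have hx := hle x (by nlinarith [sq_nonneg y, sq_nonneg z])
  have hy := hle y (by nlinarith [sq_nonneg x, sq_nonneg z])
  have hz := hle z (by nlinarith [sq_nonneg x, sq_nonneg y])
  exact ⟨⟨hx.1, hy.1, hz.1, h0.le⟩, hx.2, hy.2, hz.2, hn⟩

theorem sum_rotateQuad (n : ℕ) (G : ℤ × ℤ × ℤ × ℤ → ℝ) :
    ∑ q ∈ (finite_pythQuad n).toFinset, G (rotateQuad q) =
      ∑ q ∈ (finite_pythQuad n).toFinset, G q :=
  Finset.sum_equiv rotateQuad (fun q => by simpa using rotateQuad_mem_iff) fun _ _ => rfl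

/-- The isometry of `ℝ³` that permutes the coordinates cyclically. -/
noncomputable def rotateIsometry :
    EuclideanSpace ℝ (Fin 3) ≃ₗᵢ[ℝ] EuclideanSpace ℝ (Fin 3) :=
  LinearIsometryEquiv.piLpCongrLeft 2 ℝ ℝ (finRotate 3)

theorem rotateIsometry_pythPoint (q : ℤ × ℤ × ℤ × ℤ) :
    rotateIsometry (pythPoint (rotateQuad q)) = pythPoint q := by
  ext i
  fin_cases i <;>
  simp [rotateIsometry, pythPoint, rotateQuad, LinearIsometryEquiv.piLpCongrLeft_apply]

theorem oddSum_natCast (f : EuclideanSpace ℝ (Fin 3) → ℝ) (n : ℕ) :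
    oddSum f n = ∑ q ∈ (finite_pythQuad n).toFinset, if Odd q.1 then f (pythPoint q) else 0 := by
  refine (tsum_subtype {q : ℤ × ℤ × ℤ × ℤ | IsPrimitiveQuad q ∧ Odd q.1}
    fun q => if (q.2.2.2 : ℝ) ≤ n then f (pythPoint q) else 0).trans ?_
  rw [tsum_eq_sum (s := (finite_pythQuad n).toFinset)]
  · refine Finset.sum_congr rfl fun q hq => ?_
    rw [Set.Finite.mem_toFinset, mem_pythQuad_iff] at hq
    have hn : (q.2.2.2 : ℝ) ≤ n := by exact_mod_cast hq.2
    by_cases ho : Odd q.1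
    · exact (Set.indicator_of_mem (s := {q : ℤ × ℤ × ℤ × ℤ | IsPrimitiveQuad q ∧ Odd q.1})
        ⟨hq.1, ho⟩ _).trans (by rw [if_pos hn, if_pos ho])
    · rw [Set.indicator_of_notMem (fun h => ho h.2), if_neg ho]
  · intro q hq
    rw [Set.Finite.mem_toFinset, mem_pythQuad_iff] at hq
    rw [Set.indicator_apply_eq_zero]
    exact fun h => if_neg fun hn => hq ⟨h.1, by exact_mod_cast hn⟩

theorem sum_pythQuad_eq (f : EuclideanSpace ℝ (Fin 3) → ℝ) (n : ℕ) :
    ∑ᶠ q ∈ PythQuad n, f (pythPoint q) = oddSum f n + oddSum (f ∘ rotateIsometry) n +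
      oddSum ((f ∘ rotateIsometry) ∘ rotateIsometry) n := by
  simp only [oddSum_natCast]
  rw [finsum_mem_eq_finite_toFinset_sum _ (finite_pythQuad n),
    ← sum_rotateQuad n fun q => if Odd q.1 then (f ∘ rotateIsometry) (pythPoint q) else 0,
    ← sum_rotateQuad n fun q => if Odd q.1 then ((f ∘ rotateIsometry) ∘ rotateIsometry)
      (pythPoint q) else 0,
    ← sum_rotateQuad n fun q => if Odd (rotateQuad q).1 then
      ((f ∘ rotateIsometry) ∘ rotateIsometry) (pythPoint (rotateQuad q)) else 0,
    ← Finset.sum_add_distrib, ← Finset.sum_add_distrib]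
  refine Finset.sum_congr rfl fun q hq => ?_
  rw [Set.Finite.mem_toFinset, mem_pythQuad_iff] at hq
  obtain ⟨x, y, z, t⟩ := q
  simp only [Function.comp_apply, rotateIsometry_pythPoint]
  simp only [rotateQuad, Equiv.coe_fn_mk]
  rcases hq.1.parity with ⟨hx, hy, hz, -⟩ | ⟨hx, hy, hz, -⟩ | ⟨hx, hy, hz, -⟩ <;>
  simp only [← Int.not_odd_iff_even] at hx hy hz <;> simp [hx, hy, hz]

theorem integral_radialExt_comp_isometry (f : EuclideanSpace ℝ (Fin 3) → ℝ)
    (e : EuclideanSpace ℝ (Fin 3) ≃ₗᵢ[ℝ] EuclideanSpace ℝ (Fin 3)) :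
    ∫ x in Metric.ball 0 1, radialExt (f ∘ e) x = ∫ x in Metric.ball 0 1, radialExt f x := by
  rw [← setIntegral_ball_comp_isometry e (radialExt f)]
  simp [radialExt]

theorem exists_tendsto_sum_pythQuad : ∃ κ : ℝ, 0 < κ ∧
    ∀ f : EuclideanSpace ℝ (Fin 3) → ℝ, Continuous f →
      Tendsto (fun n : ℕ => (∑ᶠ q ∈ PythQuad n, f (pythPoint q)) / (n : ℝ) ^ 2) atTop
        (𝓝 (κ * ∫ x in Metric.ball 0 1, radialExt f x)) := by
  obtain ⟨κ, hκ, h⟩ := exists_tendsto_oddSum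
  refine ⟨3 * κ, by positivity, fun f hf => ?_⟩
  have hf1 := hf.comp rotateIsometry.continuous
  have hf2 := hf1.comp rotateIsometry.continuous
  have h0 := (h f hf).comp tendsto_natCast_atTop_atTop
  have h1 := (h _ hf1).comp tendsto_natCast_atTop_atTop
  have h2 := (h _ hf2).comp tendsto_natCast_atTop_atTop
  rw [integral_radialExt_comp_isometry] at h1
  rw [integral_radialExt_comp_isometry, integral_radialExt_comp_isometry] at h2
  convert (h0.add h1).add h2 using 2
  · rw [sum_pythQuad_eq, add_div, add_div]
    rfl
  · ring

theorem integral_radialExt_one :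
    ∫ x in Metric.ball 0 1, radialExt (fun _ => 1) x = 4 * Real.pi / 3 := by
  simp only [radialExt, setIntegral_const, smul_eq_mul, mul_one, measureReal_def,
    EuclideanSpace.volume_ball_fin_three]
  rw [ENNReal.ofReal_one, one_pow, one_mul, ENNReal.toReal_ofReal (by positivity)]
  ring

/-- The primitive Pythagorean quadruples, ordered by hypotenuse, equidistribute
on the unit sphere `S²`: for every continuous `f`, the averages of `f` over the
points `(x/t, y/t, z/t)` with `t ≤ n` converge to `(1/(4π)) ∫_{S²} f dσ`, where
`σ` is the surface measure on `S²`. -/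
theorem pythQuad_equidistributed (f : EuclideanSpace ℝ (Fin 3) → ℝ) (hf : Continuous f) :
    Filter.Tendsto
      (fun n : ℕ => (∑ᶠ q ∈ PythQuad n, f (pythPoint q)) / ((PythQuad n).ncard : ℝ))
      Filter.atTop
      (nhds ((1 / (4 * Real.pi)) *
        ∫ u : Metric.sphere (0 : EuclideanSpace ℝ (Fin 3)) 1, f u
          ∂((volume : Measure (EuclideanSpace ℝ (Fin 3))).toSphere))) := by
  obtain ⟨κ, hκ, h⟩ := exists_tendsto_sum_pythQuad
  have h1 := h (fun _ => 1) continuous_const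
  rw [integral_radialExt_one] at h1
  have hlim := (h f hf).div h1 (by positivity)
  rw [integral_toSphere_eq hf]
  convert hlim.congr' ?_ using 2
  · field_simp
  · filter_upwards [eventually_gt_atTop 0] with n hn
    have hcard : ∑ᶠ q ∈ PythQuad n, (1 : ℝ) = (PythQuad n).ncard := by
      rw [finsum_mem_eq_finite_toFinset_sum _ (finite_pythQuad n),
        Set.ncard_eq_toFinset_card _ (finite_pythQuad n)]
      simp
    have hn' : ((n : ℝ) ^ 2) ≠ 0 := by positivity
    rw [Pi.div_apply, hcard, div_div_div_cancel_right₀ hn']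
end

section
/- Fix an integer l ≥ 2. For a tuple y = (y_1,…,y_l) of positive integers and n ≥ 1, let W_n(y) be the number of words of length Σ_j y_j over the alphabet {1,…,l} having exactly y_j occurrences of each letter j and exactly n maximal runs, and for real m > 0 set T_m(y) := Σ_n W_n(y)·m^{l−n}. Then for every x = (x_1,…,x_l) ∈ ℝ_{>0}^l, writing S = Σ_j x_j, [u] for the nearest integer to u, and ⌊u⌋ for the floor of u, the ratio T_m(([m x_1],…,[m x_l])) / T_m((⌊mS/l⌋,…,⌊mS/l⌋)) converges as m → ∞ (m ranging over positive integers) to {(x_1,…,x_l)} / {(S/l,…,S/l)}, the corresponding ratio of continuous multinomial coefficients. -/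
/-- A word `w : Fin n → Fin l` is a Smirnov word if no two consecutive letters
are equal. -/
def IsSmirnov {l n : ℕ} (w : Fin n → Fin l) : Prop :=
  ∀ i : Fin n, ∀ h : (i : ℕ) + 1 < n, w i ≠ w ⟨(i : ℕ) + 1, h⟩

/-- `kcount w j` is the number of occurrences of the letter `j` in the word `w`. -/
noncomputable def kcount {l n : ℕ} (w : Fin n → Fin l) (j : Fin l) : ℕ :=
  Nat.card {i : Fin n // w i = j}

/-- The continuous multinomial coefficient
`{x} = Σ_{n≥l} Σ_w Π_{j=1}^l x_j^{k_j(w)−1}/(k_j(w)−1)!`, the inner sum ranging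
over all Smirnov words of length `n` over `{1,…,l}` in which every letter
occurs at least once. -/
noncomputable def contMultinomial (l : ℕ) (x : Fin l → ℝ) : ℝ :=
  ∑' p : Σ n : ℕ, {w : Fin n → Fin l // IsSmirnov w ∧ Function.Surjective w},
    ∏ j : Fin l, x j ^ (kcount p.2.1 j - 1) / (Nat.factorial (kcount p.2.1 j - 1) : ℝ)

/-- `Wcount l y n` is the number of words over the alphabet `{1,…,l}` having
exactly `y j` occurrences of each letter `j` (hence length `Σ_j y_j`) and
exactly `n` maximal runs (a maximal run is a maximal block of consecutive equal
letters; compressing each run to a single letter, via `destutter (· ≠ ·)`,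
yields a word of length `n`). -/
noncomputable def Wcount (l : ℕ) (y : Fin l → ℕ) (n : ℕ) : ℕ :=
  Nat.card {w : List (Fin l) //
    (∀ j, w.count j = y j) ∧ (w.destutter (· ≠ ·)).length = n}

/-- The continuum-rescaling operator `T_m(y) = Σ_n W_n(y)·m^{l−n}`, weighting
each directed lattice path with `n` segments by `m^{l−n}`. -/
noncomputable def Tm (l : ℕ) (m : ℝ) (y : Fin l → ℕ) : ℝ :=
  ∑ᶠ n : ℕ, (Wcount l y n : ℝ) * m ^ ((l : ℤ) - (n : ℤ))

/-- The number of compositions of the first argument into the second argument many positive parts. -/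
def compositionCount : ℕ → ℕ → ℕ
  | 0, 0 => 1
  | _ + 1, 0 => 0
  | 0, _ + 1 => 0
  | y + 1, k + 1 => compositionCount y (k + 1) + compositionCount y k

lemma compositionCount_succ_succ (y k : ℕ) :
    compositionCount (y + 1) (k + 1) = y.choose k := by
  induction y generalizing k with
  | zero => cases k <;> simp [compositionCount]
  | succ y ih =>
    rw [compositionCount, ih]
    cases k with
    | zero => simp [compositionCount]
    | succ k => rw [ih, Nat.choose_succ_succ, add_comm]

section Runs

variable {α : Type*} [DecidableEq α]

/-- The words whose sequence of maximal runs spells `v` and whose letter counts are `y`. -/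
def wordsWithRuns (v : List α) (y : α → ℕ) : Set (List α) :=
  {w | w.destutter (· ≠ ·) = v ∧ ∀ j, w.count j = y j}

lemma head?_destutter_ne (w : List α) : (w.destutter (· ≠ ·)).head? = w.head? := by
  cases w with
  | nil => rfl
  | cons a w =>
    rw [List.destutter_cons']
    induction w with
    | nil => rfl
    | cons b w ih =>
      rw [List.destutter'_cons]
      split_ifs with h
      · rfl
      · simpa using ih

lemma destutter_ne_cons_eq_cons_iff {a : α} {w v : List α} (h : (a :: v).IsChain (· ≠ ·)) :
    (a :: w).destutter (· ≠ ·) = a :: v ↔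
      w.destutter (· ≠ ·) = a :: v ∨ w.destutter (· ≠ ·) = v := by
  cases w with
  | nil => simp [eq_comm]
  | cons b w =>
    by_cases hab : a = b
    · subst hab
      rw [List.destutter_cons_cons, if_neg (by simp), List.destutter_cons', or_iff_left]
      intro hv
      have := head?_destutter_ne (a :: w)
      rw [List.destutter_cons', hv] at this
      cases v with
      | nil => simp at this
      | cons c v => simp_all
    · rw [List.destutter_cons_cons, if_pos hab, List.destutter_cons', or_iff_right]
      · simp
      · intro hv
        have := head?_destutter_ne (b :: w)
        rw [List.destutter_cons', hv] at this
        simp_all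

lemma head_eq_of_destutter_eq_cons {a b : α} {w v : List α}
    (h : (b :: w).destutter (· ≠ ·) = a :: v) : b = a := by
  have := head?_destutter_ne (b :: w)
  simp_all

variable [Fintype α]

lemma sum_count_eq_length (w : List α) : ∑ j, w.count j = w.length := by
  simpa using Multiset.sum_count_eq_card (s := Finset.univ) (m := (w : Multiset α)) (by simp)

lemma finite_setOf_count_eq (y : α → ℕ) : {w : List α | ∀ j, w.count j = y j}.Finite := by
  refine (List.finite_length_eq α (∑ j, y j)).subset fun w hw => ?_
  simp only [Set.mem_ofPred_eq] at hw ⊢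
  simp [← sum_count_eq_length, hw]

lemma finite_wordsWithRuns (v : List α) (y : α → ℕ) : (wordsWithRuns v y).Finite :=
  (finite_setOf_count_eq y).subset fun _ hw => hw.2

lemma wordsWithRuns_nil (y : α → ℕ) :
    (wordsWithRuns [] y).ncard = ∏ j, compositionCount (y j) 0 := by
  by_cases hy : ∀ j, y j = 0
  · have : wordsWithRuns [] y = {[]} := by
      ext w
      simp only [wordsWithRuns, Set.mem_ofPred_eq, List.destutter_eq_nil, Set.mem_singleton_iff]
      refine ⟨fun h => h.1, ?_⟩
      rintro rfl
      simp [hy]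
    simp [this, hy, compositionCount]
  · have : wordsWithRuns [] y = ∅ := by
      ext w
      simp only [wordsWithRuns, Set.mem_ofPred_eq, List.destutter_eq_nil, Set.mem_empty_iff_false,
        iff_false]
      rintro ⟨rfl, h⟩
      exact hy fun j => by simpa using (h j).symm
    push Not at hy
    obtain ⟨j, hj⟩ := hy
    obtain ⟨n, hn⟩ := Nat.exists_eq_succ_of_ne_zero hj
    rw [this, Set.ncard_empty, Finset.prod_eq_zero (Finset.mem_univ j)]
    simp [hn, compositionCount]

lemma wordsWithRuns_cons {a : α} {v : List α} (h : (a :: v).IsChain (· ≠ ·)) {y : α → ℕ} {k : ℕ}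
    (hk : y a = k + 1) :
    wordsWithRuns (a :: v) y = List.cons a ''
      (wordsWithRuns (a :: v) (Function.update y a k) ∪ wordsWithRuns v (Function.update y a k)) := by
  have key : ∀ w : List α, (∀ j, (a :: w).count j = y j) ↔
      ∀ j, w.count j = Function.update y a k j := by
    refine fun w => forall_congr' fun j => ?_
    rcases eq_or_ne j a with rfl | hj
    · simp [hk]
    · simp [hj, hj.symm]
  ext w
  simp only [wordsWithRuns, Set.mem_image, Set.mem_union, Set.mem_ofPred_eq]
  constructor
  · rintro ⟨hw, hc⟩
    cases w with
    | nil => simp at hw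
    | cons b w =>
      obtain rfl := head_eq_of_destutter_eq_cons hw
      rw [destutter_ne_cons_eq_cons_iff h] at hw
      rw [key] at hc
      exact ⟨w, by tauto, rfl⟩
  · rintro ⟨w, hw, rfl⟩
    rw [destutter_ne_cons_eq_cons_iff h, key]
    tauto

lemma ncard_wordsWithRuns {v : List α} (hv : v.IsChain (· ≠ ·)) (y : α → ℕ) :
    (wordsWithRuns v y).ncard = ∏ j, compositionCount (y j) (v.count j) := by
  induction hN : ∑ j, y j using Nat.strong_induction_on generalizing v y with
  | _ N ih =>
  cases v with
  | nil => simpa using wordsWithRuns_nil y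
  | cons a v =>
    rcases hya : y a with _ | k
    · have : wordsWithRuns (a :: v) y = ∅ := by
        ext w
        simp only [wordsWithRuns, Set.mem_ofPred_eq, Set.mem_empty_iff_false, iff_false]
        rintro ⟨hw, hc⟩
        cases w with
        | nil => simp at hw
        | cons b w =>
          obtain rfl := head_eq_of_destutter_eq_cons hw
          simpa [hya] using hc b
      rw [this, Set.ncard_empty, Finset.prod_eq_zero (Finset.mem_univ a)]
      simp [hya, compositionCount]
    · have hlt : ∑ j, Function.update y a k j < N := by
        rw [← hN]
        refine Finset.sum_lt_sum (fun j _ => ?_) ⟨a, Finset.mem_univ a, by simp [hya]⟩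
        rcases eq_or_ne j a with rfl | hj
        · simp [hya]
        · simp [hj]
      rw [wordsWithRuns_cons hv hya, Set.ncard_image_of_injective _ List.cons_injective,
        Set.ncard_union_eq _ (finite_wordsWithRuns _ _) (finite_wordsWithRuns _ _),
        ih _ hlt hv _ rfl, ih _ hlt (v := v) hv.tail _ rfl]
      · rw [← Finset.mul_prod_erase _ _ (Finset.mem_univ a),
          ← Finset.mul_prod_erase _ _ (Finset.mem_univ a),
          ← Finset.mul_prod_erase _ _ (Finset.mem_univ a)]
        have h1 : ∏ j ∈ Finset.univ.erase a,
            compositionCount (Function.update y a k j) ((a :: v).count j) =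
            ∏ j ∈ Finset.univ.erase a, compositionCount (y j) ((a :: v).count j) :=
          Finset.prod_congr rfl fun j hj => by simp [Finset.ne_of_mem_erase hj]
        have h2 : ∏ j ∈ Finset.univ.erase a,
            compositionCount (Function.update y a k j) (v.count j) =
            ∏ j ∈ Finset.univ.erase a, compositionCount (y j) ((a :: v).count j) :=
          Finset.prod_congr rfl fun j hj => by
            simp [Finset.ne_of_mem_erase hj, (Finset.ne_of_mem_erase hj).symm]
        rw [h1, h2, ← add_mul]
        simp [hya, compositionCount]
      · rw [Set.disjoint_left]
        rintro w ⟨hw, -⟩ ⟨hw', -⟩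
        simpa using congrArg List.length (hw.symm.trans hw')

end Runs

lemma kcount_eq_count_ofFn {l n : ℕ} (w : Fin n → Fin l) (j : Fin l) :
    kcount w j = (List.ofFn w).count j := by
  have := Fin.card_filter_univ_eq_vector_get_eq_count j (List.Vector.ofFn w)
  simp only [List.Vector.get_ofFn, List.Vector.toList_ofFn] at this
  rw [kcount, Nat.card_eq_fintype_card, Fintype.card_subtype, ← this]

lemma isSmirnov_iff_isChain_ofFn {l n : ℕ} (w : Fin n → Fin l) :
    IsSmirnov w ↔ (List.ofFn w).IsChain (· ≠ ·) := by
  rw [List.isChain_ofFn]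
  exact ⟨fun h i hi => h ⟨i, by omega⟩ hi, fun h i hi => h i hi⟩

lemma kcount_pos_of_surjective {l n : ℕ} {w : Fin n → Fin l} (hw : Function.Surjective w)
    (j : Fin l) : 0 < kcount w j := by
  obtain ⟨i, hi⟩ := hw j
  rw [kcount_eq_count_ofFn, List.count_pos_iff, List.mem_ofFn]
  exact ⟨i, hi⟩

lemma sum_kcount {l n : ℕ} (w : Fin n → Fin l) : ∑ j, kcount w j = n := by
  simp only [kcount_eq_count_ofFn, sum_count_eq_length, List.length_ofFn]

lemma Wcount_eq_sum_ncard {l n : ℕ} (y : Fin l → ℕ) :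
    Wcount l y n = ∑ v : Fin n → Fin l, (wordsWithRuns (List.ofFn v) y).ncard := by
  have e : {w : List (Fin l) // (∀ j, w.count j = y j) ∧ (w.destutter (· ≠ ·)).length = n} ≃
      Σ v : Fin n → Fin l, wordsWithRuns (List.ofFn v) y :=
    { toFun := fun w => ⟨fun i => (w.1.destutter (· ≠ ·)).get (i.cast w.2.2.symm), w.1, by
        refine ⟨List.ext_get (by simp [w.2.2]) fun i _ _ => by simp, w.2.1⟩⟩
      invFun := fun p => ⟨p.2.1, p.2.2.2, by rw [p.2.2.1, List.length_ofFn]⟩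
      left_inv := fun w => rfl
      right_inv := by
        rintro ⟨v, w, hw, hc⟩
        exact Sigma.subtype_ext (by funext i; simp [hw]) rfl }
  have (v : Fin n → Fin l) : Finite (wordsWithRuns (List.ofFn v) y) := finite_wordsWithRuns _ _
  rw [Wcount, Nat.card_congr e, Nat.card_sigma]
  rfl

lemma ncard_wordsWithRuns_eq_zero {l n : ℕ} {v : Fin n → Fin l} {y : Fin l → ℕ}
    (hy : ∀ j, 0 < y j) (hv : ¬ (IsSmirnov v ∧ Function.Surjective v)) :
    (wordsWithRuns (List.ofFn v) y).ncard = 0 := by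
  by_cases hs : IsSmirnov v
  · obtain ⟨j, hj⟩ : ∃ j, ∀ i, v i ≠ j := by
      simpa [Function.Surjective, hs] using hv
    rw [ncard_wordsWithRuns ((isSmirnov_iff_isChain_ofFn v).1 hs),
      Finset.prod_eq_zero (Finset.mem_univ j)]
    rw [List.count_eq_zero.2 (by simpa [List.mem_ofFn] using hj)]
    obtain ⟨k, hk⟩ := Nat.exists_eq_succ_of_ne_zero (hy j).ne'
    simp [hk, compositionCount]
  · rw [Set.ncard_eq_zero (finite_wordsWithRuns _ _), Set.eq_empty_iff_forall_notMem]
    rintro w ⟨hw, -⟩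
    rw [isSmirnov_iff_isChain_ofFn, ← hw] at hs
    exact hs (List.isChain_destutter _ _)

lemma Wcount_eq_sum_prod_choose {l n : ℕ} {y : Fin l → ℕ} (hy : ∀ j, 0 < y j)
    [Fintype {w : Fin n → Fin l // IsSmirnov w ∧ Function.Surjective w}] :
    Wcount l y n = ∑ v : {w : Fin n → Fin l // IsSmirnov w ∧ Function.Surjective w},
      ∏ j, (y j - 1).choose (kcount v.1 j - 1) := by
  classical
  have key : ∀ v : {w : Fin n → Fin l // IsSmirnov w ∧ Function.Surjective w},
      ∏ j, (y j - 1).choose (kcount v.1 j - 1) = (wordsWithRuns (List.ofFn v.1) y).ncard := by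
    rintro ⟨v, hv, hs⟩
    rw [ncard_wordsWithRuns ((isSmirnov_iff_isChain_ofFn v).1 hv)]
    refine Finset.prod_congr rfl fun j _ => ?_
    rw [← kcount_eq_count_ofFn, ← compositionCount_succ_succ, Nat.sub_add_cancel (hy j),
      Nat.sub_add_cancel (kcount_pos_of_surjective hs j)]
  rw [Wcount_eq_sum_ncard, Finset.sum_congr rfl fun v _ => key v,
    ← Finset.sum_subtype (Finset.univ.filter fun v => IsSmirnov v ∧ Function.Surjective v)
      (by simp) fun v => (wordsWithRuns (List.ofFn v) y).ncard]
  refine (Finset.sum_filter_of_ne fun v _ hv => ?_).symm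
  contrapose! hv
  exact ncard_wordsWithRuns_eq_zero hy (by tauto)

/-- The Smirnov words over `Fin l` in which every letter occurs, with their length. -/
abbrev SurjSmirnovWord (l : ℕ) : Type :=
  Σ n : ℕ, {w : Fin n → Fin l // IsSmirnov w ∧ Function.Surjective w}

lemma SurjSmirnovWord.sum_kcount_sub_one {l : ℕ} (p : SurjSmirnovWord l) :
    ∑ j, (kcount p.2.1 j - 1) + l = p.1 := by
  conv_rhs => rw [← sum_kcount p.2.1]
  have : ∀ j, kcount p.2.1 j = (kcount p.2.1 j - 1) + 1 := fun j =>
    (Nat.sub_add_cancel (kcount_pos_of_surjective p.2.2.2 j)).symm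
  conv_rhs => rw [Finset.sum_congr rfl fun j _ => this j]
  simp [Finset.sum_add_distrib]

lemma prod_pow_div_factorial_le {ι : Type*} [Fintype ι] [DecidableEq ι] {x : ι → ℝ}
    (hx : ∀ i, 0 ≤ x i) (e : ι → ℕ) :
    ∏ i, x i ^ e i / ((e i).factorial : ℝ) ≤ (∑ i, x i) ^ (∑ i, e i) / (∑ i, e i).factorial := by
  have hspec : ((∏ i, (e i).factorial : ℕ) : ℝ) * Nat.multinomial Finset.univ e =
      (∑ i, e i).factorial := by
    exact_mod_cast Nat.multinomial_spec Finset.univ e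
  have hpos : 0 < ((∏ i, (e i).factorial : ℕ) : ℝ) := by
    exact_mod_cast Finset.prod_pos fun i _ => (e i).factorial_pos
  have hle : (Nat.multinomial Finset.univ e : ℝ) * ∏ i, x i ^ e i ≤ (∑ i, x i) ^ (∑ i, e i) := by
    rw [Finset.sum_pow_eq_sum_piAntidiag]
    refine Finset.single_le_sum (f := fun k => (Nat.multinomial Finset.univ k : ℝ) * ∏ i, x i ^ k i)
      (fun k _ => ?_) (by simp)
    exact mul_nonneg (Nat.cast_nonneg _) (Finset.prod_nonneg fun i _ => pow_nonneg (hx i) _)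
  rw [Finset.prod_div_distrib, ← Nat.cast_prod, div_le_div_iff₀ hpos (by positivity), ← hspec]
  nlinarith

lemma summable_pow_div_factorial_length (l : ℕ) {C : ℝ} (hC : 0 ≤ C) :
    Summable fun p : SurjSmirnovWord l => C ^ (p.1 - l) / ((p.1 - l).factorial : ℝ) := by
  classical
  rw [summable_sigma_of_nonneg fun p => by positivity]
  refine ⟨fun n => Summable.of_finite, ?_⟩
  have hs : Summable fun n : ℕ => (l : ℝ) ^ n * (C ^ (n - l) / ((n - l).factorial : ℝ)) := by
    rw [← summable_nat_add_iff l]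
    refine ((Real.summable_pow_div_factorial (l * C)).mul_left ((l : ℝ) ^ l)).congr fun n => ?_
    rw [Nat.add_sub_cancel, pow_add, mul_pow]
    ring
  refine hs.of_nonneg_of_le (fun n => tsum_nonneg fun _ => by positivity) fun n => ?_
  dsimp only
  rw [tsum_const, nsmul_eq_mul]
  refine mul_le_mul_of_nonneg_right ?_ (by positivity)
  have := Finite.card_subtype_le (fun w : Fin n → Fin l => IsSmirnov w ∧ Function.Surjective w)
  rw [Nat.card_eq_fintype_card (α := Fin n → Fin l)] at this
  simp only [Fintype.card_pi, Fintype.card_fin, Finset.prod_const, Finset.card_univ] at this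
  exact_mod_cast this

lemma contMultinomial_term_le {l : ℕ} {x : Fin l → ℝ} (hx : ∀ j, 0 ≤ x j) (p : SurjSmirnovWord l) :
    ∏ j, x j ^ (kcount p.2.1 j - 1) / (Nat.factorial (kcount p.2.1 j - 1) : ℝ) ≤
      (∑ j, x j) ^ (p.1 - l) / ((p.1 - l).factorial : ℝ) := by
  have := prod_pow_div_factorial_le hx fun j => kcount p.2.1 j - 1
  rwa [show ∑ j, (kcount p.2.1 j - 1) = p.1 - l by
    have := p.sum_kcount_sub_one; omega] at this

/-- The contribution of the Smirnov word `p` to `Tm l m y`. -/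
noncomputable def tmTerm {l : ℕ} (m : ℝ) (y : Fin l → ℕ) (p : SurjSmirnovWord l) : ℝ :=
  ∏ j, ((y j - 1).choose (kcount p.2.1 j - 1) : ℝ) / m ^ (kcount p.2.1 j - 1)

lemma tmTerm_nonneg {l : ℕ} {m : ℝ} (hm : 0 < m) (y : Fin l → ℕ) (p : SurjSmirnovWord l) :
    0 ≤ tmTerm m y p :=
  Finset.prod_nonneg fun _ _ => by positivity

lemma tmTerm_le {l : ℕ} {m : ℝ} (hm : 0 < m) {y : Fin l → ℕ} {B : Fin l → ℝ}
    (hB : ∀ j, (y j : ℝ) / m ≤ B j) (p : SurjSmirnovWord l) :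
    tmTerm m y p ≤ (∑ j, B j) ^ (p.1 - l) / ((p.1 - l).factorial : ℝ) := by
  refine le_trans (Finset.prod_le_prod (fun _ _ => by positivity) fun j _ => ?_)
    (contMultinomial_term_le (fun j => le_trans (by positivity) (hB j)) p)
  set k := kcount p.2.1 j - 1
  calc ((y j - 1).choose k : ℝ) / m ^ k
      ≤ ((y j : ℝ) ^ k / k.factorial) / m ^ k := by
        gcongr
        refine (Nat.choose_le_pow_div k (y j - 1)).trans ?_
        gcongr
        exact Nat.sub_le _ _
    _ = ((y j : ℝ) / m) ^ k / k.factorial := by rw [div_pow, div_right_comm]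
    _ ≤ B j ^ k / k.factorial := by gcongr; exact hB j

lemma Wcount_eq_zero_of_sum_lt {l n : ℕ} {y : Fin l → ℕ} (h : ∑ j, y j < n) : Wcount l y n = 0 := by
  rw [Wcount, Nat.card_eq_zero]
  refine Or.inl ⟨fun ⟨w, hc, hn⟩ => ?_⟩
  have h1 := (List.destutter_sublist (· ≠ ·) w).length_le
  have h2 := sum_count_eq_length w
  simp only [hc] at h2
  omega

lemma Tm_eq_tsum {l : ℕ} {m : ℝ} (hm : 0 < m) {y : Fin l → ℕ} (hy : ∀ j, 0 < y j) :
    Tm l m y = ∑' p, tmTerm m y p := by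
  classical
  have hs : Summable (tmTerm m y) :=
    (summable_pow_div_factorial_length l (C := ∑ j, (y j : ℝ) / m) (by positivity)).of_nonneg_of_le
      (tmTerm_nonneg hm y) (tmTerm_le hm fun _ => le_rfl)
  have := fun n : ℕ =>
    Fintype.ofFinite {w : Fin n → Fin l // IsSmirnov w ∧ Function.Surjective w}
  rw [hs.tsum_sigma' fun n => Summable.of_finite, Tm,
    ← tsum_eq_finsum (L := SummationFilter.unconditional ℕ)]
  · refine tsum_congr fun n => ?_
    rw [tsum_fintype, Wcount_eq_sum_prod_choose hy, Nat.cast_sum, Finset.sum_mul]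
    refine Finset.sum_congr rfl fun v _ => ?_
    have hn : ∑ j, (kcount v.1 j - 1) + l = n := SurjSmirnovWord.sum_kcount_sub_one ⟨n, v⟩
    rw [tmTerm, Finset.prod_div_distrib, Finset.prod_pow_eq_pow_sum, div_eq_mul_inv, Nat.cast_prod,
      ← zpow_natCast, ← zpow_neg]
    congr 2
    simp only
    omega
  · refine (Set.finite_Iic (∑ j, y j)).subset fun n hn => ?_
    by_contra h
    exact hn (by simp [Wcount_eq_zero_of_sum_lt (not_le.1 h)])

lemma tendsto_choose_div_pow {y : ℕ → ℕ} {a : ℝ}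
    (hy : Filter.Tendsto (fun m : ℕ => (y m : ℝ) / m) Filter.atTop (nhds a)) (k : ℕ) :
    Filter.Tendsto (fun m : ℕ => ((y m).choose k : ℝ) / (m : ℝ) ^ k) Filter.atTop
      (nhds (a ^ k / k.factorial)) := by
  induction k with
  | zero => simp
  | succ k ih =>
    have hk : Filter.Tendsto (fun m : ℕ => (k : ℝ) / m) Filter.atTop (nhds 0) :=
      tendsto_const_div_atTop_nhds_zero_nat _
    have hlim := (ih.mul (hy.sub hk)).div_const ((k : ℝ) + 1)
    have heq : a ^ k / k.factorial * (a - 0) / ((k : ℝ) + 1) = a ^ (k + 1) / (k + 1).factorial := by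
      rw [Nat.factorial_succ]
      push_cast
      field_simp
      ring
    rw [heq] at hlim
    refine hlim.congr fun m => ?_
    have hrec : ((y m).choose (k + 1) : ℝ) * (k + 1) = (y m).choose k * ((y m : ℝ) - k) := by
      rcases le_or_gt k (y m) with h | h
      · have := Nat.choose_succ_right_eq (y m) k
        rw [← Nat.cast_sub h]
        exact_mod_cast this
      · rw [Nat.choose_eq_zero_of_lt h, Nat.choose_eq_zero_of_lt (by omega)]
        simp
    have hk1 : (k : ℝ) + 1 ≠ 0 := by positivity
    rw [← sub_div, div_eq_iff hk1, div_mul_div_comm, ← hrec, pow_succ]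
    ring

lemma tendsto_Tm {l : ℕ} {x : Fin l → ℝ} (hx : ∀ j, 0 < x j) {y : ℕ → Fin l → ℕ}
    (hy : ∀ j, Filter.Tendsto (fun m : ℕ => (y m j : ℝ) / m) Filter.atTop (nhds (x j))) :
    Filter.Tendsto (fun m : ℕ => Tm l m (y m)) Filter.atTop (nhds (contMultinomial l x)) := by
  have hpos : ∀ᶠ m : ℕ in Filter.atTop, ∀ j, 0 < y m j := by
    refine Filter.eventually_all.2 fun j => ?_
    filter_upwards [(hy j).eventually (lt_mem_nhds (hx j))] with m hm
    by_contra h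
    simp [Nat.eq_zero_of_not_pos h] at hm
  have hle : ∀ᶠ m : ℕ in Filter.atTop, ∀ j, (y m j : ℝ) / m ≤ x j + 1 :=
    Filter.eventually_all.2 fun j => (hy j).eventually (ge_mem_nhds (lt_add_one _))
  have hlim : Filter.Tendsto (fun m : ℕ => ∑' p, tmTerm (m : ℝ) (y m) p) Filter.atTop
      (nhds (contMultinomial l x)) := by
    refine tendsto_tsum_of_dominated_convergence
      (summable_pow_div_factorial_length l (C := ∑ j, (x j + 1))
        (Finset.sum_nonneg fun j _ => by linarith [hx j])) (fun p => ?_) ?_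
    · refine tendsto_finsetProd _ fun j _ => tendsto_choose_div_pow (y := fun m => y m j - 1) ?_ _
      have h1 : Filter.Tendsto (fun m : ℕ => (1 : ℝ) / m) Filter.atTop (nhds 0) :=
        tendsto_const_div_atTop_nhds_zero_nat _
      have := (hy j).sub h1
      rw [sub_zero] at this
      refine this.congr' ?_
      filter_upwards [hpos] with m hm
      rw [Nat.cast_sub (hm j), Nat.cast_one, sub_div]
    · filter_upwards [hle, Filter.eventually_gt_atTop 0] with m hm hm0 p
      have hm0' : (0 : ℝ) < m := by exact_mod_cast hm0
      rw [Real.norm_of_nonneg (tmTerm_nonneg hm0' _ _)]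
      exact tmTerm_le hm0' hm p
  refine hlim.congr' ?_
  filter_upwards [hpos, Filter.eventually_gt_atTop 0] with m hm hm0
  exact (Tm_eq_tsum (by exact_mod_cast hm0) hm).symm

lemma contMultinomial_pos {l : ℕ} {x : Fin l → ℝ} (hx : ∀ j, 0 < x j) :
    0 < contMultinomial l x := by
  have hterm : ∀ p : SurjSmirnovWord l,
      0 < ∏ j, x j ^ (kcount p.2.1 j - 1) / (Nat.factorial (kcount p.2.1 j - 1) : ℝ) := fun p =>
    Finset.prod_pos fun j _ => div_pos (pow_pos (hx j) _) (by positivity)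
  have hs := (summable_pow_div_factorial_length l (C := ∑ j, x j)
    (Finset.sum_nonneg fun j _ => (hx j).le)).of_nonneg_of_le (fun p => (hterm p).le)
    (contMultinomial_term_le fun j => (hx j).le)
  refine hs.tsum_pos (fun p => (hterm p).le) ⟨l, id, fun i h hi => ?_, Function.surjective_id⟩
    (hterm _)
  simpa using congrArg Fin.val hi

lemma tendsto_round_mul_toNat_div {a : ℝ} (ha : 0 ≤ a) :
    Filter.Tendsto (fun m : ℕ => ((round ((m : ℝ) * a)).toNat : ℝ) / m) Filter.atTop (nhds a) := by
  have h1 : Filter.Tendsto (fun m : ℕ => (1 : ℝ) / m) Filter.atTop (nhds 0) :=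
    tendsto_const_div_atTop_nhds_zero_nat _
  rw [tendsto_iff_dist_tendsto_zero]
  refine squeeze_zero' (Filter.Eventually.of_forall fun _ => dist_nonneg) ?_ h1
  filter_upwards [Filter.eventually_gt_atTop 0] with m hm
  have hm' : (0 : ℝ) < m := by exact_mod_cast hm
  have hr : 0 ≤ round ((m : ℝ) * a) := by
    rw [round_eq]
    exact Int.floor_nonneg.2 (by positivity)
  have hcast : ((round ((m : ℝ) * a)).toNat : ℝ) = (round ((m : ℝ) * a) : ℝ) := by
    exact_mod_cast congrArg (Int.cast (R := ℝ)) (Int.toNat_of_nonneg hr)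
  have habs := abs_sub_round ((m : ℝ) * a)
  rw [hcast, Real.dist_eq, abs_sub_comm, show a - (round ((m : ℝ) * a) : ℝ) / m =
    ((m : ℝ) * a - round ((m : ℝ) * a)) / m by field_simp, abs_div, abs_of_pos hm']
  gcongr
  linarith

/-- For `l ≥ 2` and `x ∈ ℝ_{>0}^l` with `S = Σ_j x_j`, the ratio
`T_m(([m x_1],…,[m x_l])) / T_m((⌊mS/l⌋,…,⌊mS/l⌋))` converges, as the positive
integer `m → ∞`, to the corresponding ratio
`{(x_1,…,x_l)}/{(S/l,…,S/l)}` of continuous multinomial coefficients.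
Here `[u]` is the nearest integer to `u` and `⌊u⌋` the floor of `u`. -/
theorem Tm_ratio_tendsto_contMultinomial_ratio (l : ℕ) (hl : 2 ≤ l)
    (x : Fin l → ℝ) (hx : ∀ i, 0 < x i) :
    Filter.Tendsto
      (fun m : ℕ =>
        Tm l (m : ℝ) (fun i => (round ((m : ℝ) * x i)).toNat) /
        Tm l (m : ℝ) (fun _ => Nat.floor ((m : ℝ) * (∑ j, x j) / (l : ℝ))))
      Filter.atTop
      (nhds (contMultinomial l x / contMultinomial l (fun _ => (∑ j, x j) / (l : ℝ)))) := by
  have : Nonempty (Fin l) := ⟨⟨0, by omega⟩⟩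
  have hl0 : (0 : ℝ) < l := by exact_mod_cast (by omega : 0 < l)
  have hS : 0 < (∑ j, x j) / (l : ℝ) :=
    div_pos (Finset.sum_pos (fun j _ => hx j) Finset.univ_nonempty) hl0
  refine (tendsto_Tm hx fun j => tendsto_round_mul_toNat_div (hx j).le).div
    (tendsto_Tm (fun _ => hS) fun _ => ?_) (contMultinomial_pos fun _ => hS).ne'
  refine ((tendsto_nat_floor_mul_div_atTop hS.le).comp
    (tendsto_natCast_atTop_atTop (R := ℝ))).congr fun m => ?_
  simp only [Function.comp_apply]
  rw [mul_comm, mul_div_assoc]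
end
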